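/- arXiv:2206.00896 — 2 statements merged into one kernel-verified Lean document; each statement's English description precedes it below -/
import Mathlib

section
/- With r = alpha·infinity = (T^2+T+1)/T^3 in K, the family gamma -> (r - gamma omega)/(r - gamma(alpha omega)), indexed by gamma in Gamma, is multipliable; its product c satisfies |c - T^4| < 1, and t := c^{-1} satisfies |t - pi^4| < 2^{-8}, where pi = 1/T. (This is the computation of the multiplier c_alpha(alpha) and of the generator t of the lattice Lambda in Section 8.1 of the paper.) -/
open Polynomial Matrix
open scoped Classical

/-- The absolute value on `K_∞ = F₂((π))`: `|x| = 2^{-v_∞(x)}`. -/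
noncomputable def absK2 (x : LaurentSeries (ZMod 2)) : ℝ :=
  if x = 0 then 0 else (2 : ℝ) ^ (-(HahnSeries.order x))

/-- The element `T = π⁻¹` of `K_∞ = F₂((π))`. -/
noncomputable def Tel2 : LaurentSeries (ZMod 2) :=
  HahnSeries.single (-1 : ℤ) 1

/-- The embedding `A = F₂[T] → C`, sending `T` to `π⁻¹`. -/
noncomputable def polyEmb2 (C : Type*) [NormedField C]
    [Algebra (LaurentSeries (ZMod 2)) C] : Polynomial (ZMod 2) →+* C :=
  (algebraMap (LaurentSeries (ZMod 2)) C).comp (Polynomial.aeval Tel2).toRingHom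

/-- The action of a matrix over `A = F₂[T]` on `C` by fractional linear
transformations. -/
noncomputable def act2 {C : Type*} [NormedField C] [Algebra (LaurentSeries (ZMod 2)) C]
    (g : Matrix (Fin 2) (Fin 2) (Polynomial (ZMod 2))) (z : C) : C :=
  (polyEmb2 C (g 0 0) * z + polyEmb2 C (g 0 1)) /
    (polyEmb2 C (g 1 0) * z + polyEmb2 C (g 1 1))

/-- `Γ = Γ₀(T³) = {[[a,b],[c,d]] : a,b,c,d ∈ F₂[T], ad - bc = 1, T³ ∣ c}`. -/
def Gamma0T3 : Set (Matrix (Fin 2) (Fin 2) (Polynomial (ZMod 2))) :=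
  {g | g.det = 1 ∧ (Polynomial.X : Polynomial (ZMod 2)) ^ 3 ∣ g 1 0}

/-- The matrix `α = [[T²+T+1, 1],[T³, 1+T]] ∈ Γ₀(T³)`. -/
noncomputable def alpha2 : Matrix (Fin 2) (Fin 2) (Polynomial (ZMod 2)) :=
  !![Polynomial.X ^ 2 + Polynomial.X + 1, 1; Polynomial.X ^ 3, 1 + Polynomial.X]

/-! ### Polynomials over `𝔽₂` as binary expansions -/

/-- The polynomial over `𝔽₂` whose coefficients are the binary digits of `n`. -/
noncomputable def ofBits : ℕ → (ZMod 2)[X]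
  | 0 => 0
  | n + 1 => ((n + 1 : ℕ) : (ZMod 2)[X]) + X * ofBits ((n + 1) / 2)
decreasing_by omega

theorem ofBits_zero : ofBits 0 = 0 := by rw [ofBits]

theorem ofBits_eq (n : ℕ) : ofBits n = (n : (ZMod 2)[X]) + X * ofBits (n / 2) := by
  cases n with
  | zero => simp [ofBits_zero]
  | succ n => rw [ofBits]

theorem ofBits_one : ofBits 1 = 1 := by
  rw [ofBits_eq]; simp [ofBits_zero]

theorem ofBits_two_mul (n : ℕ) : ofBits (2 * n) = X * ofBits n := by
  rw [ofBits_eq, Nat.mul_div_cancel_left n two_pos]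
  have h : ((2 : ℕ) : (ZMod 2)[X]) = 0 := CharP.cast_eq_zero _ 2
  rw [Nat.cast_mul, h, zero_mul, zero_add]

theorem ofBits_two_mul_add_one (n : ℕ) : ofBits (2 * n + 1) = 1 + X * ofBits n := by
  rw [ofBits_eq, show (2 * n + 1) / 2 = n by omega]
  have h : ((2 : ℕ) : (ZMod 2)[X]) = 0 := CharP.cast_eq_zero _ 2
  rw [Nat.cast_add, Nat.cast_mul, h, zero_mul, zero_add, Nat.cast_one]

theorem ofBits_eight_mul (n : ℕ) : ofBits (8 * n) = X ^ 3 * ofBits n := by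
  rw [show 8 * n = 2 * (2 * (2 * n)) by ring]
  simp only [ofBits_two_mul]
  ring

theorem ofBits_xor (a b : ℕ) : ofBits (Nat.xor a b) = ofBits a + ofBits b := by
  induction a using Nat.strong_induction_on generalizing b with
  | _ a ih =>
    rcases Nat.eq_zero_or_pos a with rfl | ha
    · rw [show Nat.xor 0 b = b from Nat.zero_xor b, ofBits_zero, zero_add]
    · have hcast : ((Nat.xor a b : ℕ) : (ZMod 2)[X]) = a + b := by
        rw [← Nat.cast_add, CharP.cast_eq_mod _ 2 (Nat.xor a b), CharP.cast_eq_mod _ 2 (a + b)]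
        exact congrArg _ Nat.xor_mod_two_eq
      have hdiv : Nat.xor a b / 2 = Nat.xor (a / 2) (b / 2) := Nat.xor_div_two
      rw [ofBits_eq (Nat.xor a b), hcast, hdiv, ih _ (Nat.div_lt_self ha one_lt_two),
        ofBits_eq a, ofBits_eq b]
      ring

theorem coeff_zero_ofBits (n : ℕ) : (ofBits n).coeff 0 = n := by
  rw [ofBits_eq]; simp

theorem coeff_succ_ofBits (n k : ℕ) : (ofBits n).coeff (k + 1) = (ofBits (n / 2)).coeff k := by
  rw [ofBits_eq]
  simp [Polynomial.coeff_natCast_ite]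

theorem eq_zero_of_ofBits_eq_zero {n : ℕ} (h : ofBits n = 0) : n = 0 := by
  induction n using Nat.strong_induction_on with
  | _ n ih =>
    by_contra hn
    have h₀ : (n : ZMod 2) = 0 := by rw [← coeff_zero_ofBits, h, Polynomial.coeff_zero]
    have h₁ : ofBits (n / 2) = 0 := by
      ext k
      rw [← coeff_succ_ofBits, h, Polynomial.coeff_zero, Polynomial.coeff_zero]
    have h₂ := ih (n / 2) (by omega) h₁
    have h₃ := (ZMod.natCast_eq_zero_iff n 2).1 h₀
    omega

theorem ofBits_injective : Function.Injective ofBits := fun m n h =>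
  Nat.xor_eq_zero_iff.1 (eq_zero_of_ofBits_eq_zero
    ((ofBits_xor m n).trans (by rw [h, CharTwo.add_self_eq_zero])))

theorem degree_ofBits_lt {n k : ℕ} (h : n < 2 ^ k) : (ofBits n).degree < k := by
  rw [Polynomial.degree_lt_iff_coeff_zero]
  induction k generalizing n with
  | zero =>
    obtain rfl : n = 0 := by omega
    simp [ofBits_zero]
  | succ k ih =>
    intro m hm
    obtain ⟨m, rfl⟩ : ∃ j, m = j + 1 := ⟨m - 1, by omega⟩
    rw [coeff_succ_ofBits]
    exact ih (by omega) m (by omega)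

theorem zmod_two_eq_zero_or_one : ∀ t : ZMod 2, t = 0 ∨ t = 1 := by decide

theorem exists_ofBits_eq_of_degree_lt {k : ℕ} {P : (ZMod 2)[X]} (h : P.degree < k) :
    ∃ n < 2 ^ k, ofBits n = P := by
  rw [Polynomial.degree_lt_iff_coeff_zero] at h
  induction k generalizing P with
  | zero => exact ⟨0, by simp, by ext m; simp [ofBits_zero, h m]⟩
  | succ k ih =>
    obtain ⟨n, hn, hP⟩ := ih (P := P.divX) fun m hm => by
      rw [Polynomial.coeff_divX]; exact h _ (by omega)
    have hdiv := Polynomial.divX_mul_X_add P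
    rw [← hP] at hdiv
    rcases zmod_two_eq_zero_or_one (P.coeff 0) with h₀ | h₀
    · refine ⟨2 * n, by omega, ?_⟩
      rw [← hdiv, h₀, ofBits_two_mul]; simp [mul_comm]
    · refine ⟨2 * n + 1, by omega, ?_⟩
      rw [← hdiv, h₀, ofBits_two_mul_add_one]; simp [mul_comm, add_comm]

theorem degree_ofBits_lt_iff {n k : ℕ} : (ofBits n).degree < k ↔ n < 2 ^ k := by
  refine ⟨fun h => ?_, degree_ofBits_lt⟩
  obtain ⟨m, hm, he⟩ := exists_ofBits_eq_of_degree_lt h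
  exact ofBits_injective he ▸ hm

/-- `k n`, written so that the kernel evaluates `n` before substituting it into `k`. -/
def evalFirst {α : Type} (n : ℕ) (k : ℕ → α) : α :=
  Nat.rec (k 0) (fun m _ => k (m + 1)) n

theorem evalFirst_eq {α : Type} (n : ℕ) (k : ℕ → α) : evalFirst n k = k n := by
  cases n <;> rfl

/-- Carry-less product of binary expansions, by recursion on a bound for the second factor. -/
def bitMulAux (a k : ℕ) : ℕ → ℕ :=
  Nat.rec (fun _ => 0)
    (fun _ ih b => cond (Nat.beq b 0) 0
      (Nat.xor (cond (Nat.beq (b % 2) 1) a 0) (2 * ih (b / 2)))) k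

/-- Carry-less product of binary expansions. -/
def bitMul (a b : ℕ) : ℕ :=
  evalFirst a fun a => evalFirst b fun b => bitMulAux a b b

theorem ofBits_bitMulAux (a : ℕ) {k b : ℕ} (h : b ≤ k) :
    ofBits (bitMulAux a k b) = ofBits a * ofBits b := by
  induction k generalizing b with
  | zero =>
    obtain rfl : b = 0 := by omega
    rw [show bitMulAux a 0 0 = 0 from rfl, ofBits_zero, mul_zero]
  | succ k ih =>
    rw [show bitMulAux a (k + 1) b = cond (Nat.beq b 0) 0
      (Nat.xor (cond (Nat.beq (b % 2) 1) a 0) (2 * bitMulAux a k (b / 2))) from rfl]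
    rcases Nat.eq_zero_or_pos b with rfl | hb
    · rw [Nat.beq_refl, cond_true, ofBits_zero, mul_zero]
    · have hb' : Nat.beq b 0 = false := by
        rw [Bool.eq_false_iff]; intro h0; have := Nat.eq_of_beq_eq_true h0; omega
      rw [hb', cond_false, ofBits_xor, ofBits_two_mul, ih (by omega)]
      rcases Nat.mod_two_eq_zero_or_one b with h2 | h2
      · obtain ⟨m, rfl⟩ : ∃ m, b = 2 * m := ⟨b / 2, by omega⟩
        rw [h2, Nat.mul_div_cancel_left m two_pos, ofBits_two_mul,
          show Nat.beq 0 1 = false from rfl, cond_false, ofBits_zero]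
        ring
      · obtain ⟨m, rfl⟩ : ∃ m, b = 2 * m + 1 := ⟨b / 2, by omega⟩
        rw [h2, show (2 * m + 1) / 2 = m by omega, ofBits_two_mul_add_one,
          show Nat.beq 1 1 = true from rfl, cond_true]
        ring

theorem ofBits_bitMul (a b : ℕ) : ofBits (bitMul a b) = ofBits a * ofBits b := by
  rw [bitMul, evalFirst_eq, evalFirst_eq, ofBits_bitMulAux a le_rfl]

theorem ofBits_three : ofBits 3 = X + 1 := by
  rw [show 3 = 2 * 1 + 1 by rfl, ofBits_two_mul_add_one, ofBits_one]; ring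

theorem ofBits_seven : ofBits 7 = X ^ 2 + X + 1 := by
  rw [show 7 = 2 * 3 + 1 by rfl, ofBits_two_mul_add_one, ofBits_three]; ring

theorem ofBits_twelve : ofBits 12 = X ^ 3 + X ^ 2 := by
  rw [show 12 = 2 * (2 * 3) by rfl, ofBits_two_mul, ofBits_two_mul, ofBits_three]; ring

/-! ### Infinite products over a nonarchimedean field -/

section Ultrametric

variable {C ι : Type*} [NormedField C] [IsUltrametricDist C]

theorem norm_prod_one_add_sub_one_le (s : Finset ι) {x : ι → C} {r : ℝ} (hr₀ : 0 ≤ r)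
    (hr₁ : r ≤ 1) (hx : ∀ i ∈ s, ‖x i‖ ≤ r) : ‖∏ i ∈ s, (1 + x i) - 1‖ ≤ r := by
  induction s using Finset.induction_on with
  | empty => simpa using hr₀
  | insert i s hi ih =>
    have ih' := ih fun j hj => hx j (Finset.mem_insert_of_mem hj)
    have hxi := hx i (Finset.mem_insert_self i s)
    rw [Finset.prod_insert hi, show (1 + x i) * ∏ j ∈ s, (1 + x j) - 1 =
      (1 + x i) * (∏ j ∈ s, (1 + x j) - 1) + x i by ring]
    have h₁ : ‖1 + x i‖ ≤ 1 :=
      (IsUltrametricDist.norm_add_le_max _ _).trans (max_le norm_one.le (hxi.trans hr₁))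
    refine (IsUltrametricDist.norm_add_le_max _ _).trans (max_le ?_ hxi)
    rw [norm_mul]
    exact (mul_le_of_le_one_left (norm_nonneg _) h₁).trans ih'

theorem norm_prod_one_add_sub_prod_le {s t : Finset ι} (hst : s ⊆ t) {x : ι → C} {r : ℝ}
    (hr₀ : 0 ≤ r) (hr₁ : r ≤ 1) (hx : ∀ i ∉ s, ‖x i‖ ≤ r) :
    ‖∏ i ∈ t, (1 + x i) - ∏ i ∈ s, (1 + x i)‖ ≤ r * ‖∏ i ∈ s, (1 + x i)‖ := by
  rw [← Finset.prod_sdiff hst, ← sub_one_mul, norm_mul]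
  gcongr
  exact norm_prod_one_add_sub_one_le _ hr₀ hr₁ fun i hi => hx i (Finset.mem_sdiff.1 hi).2

theorem multipliable_one_add_of_finite_lt_norm [CompleteSpace C] {x : ι → C}
    (hx : ∀ ε > 0, {i | ε < ‖x i‖}.Finite) : Multipliable fun i => 1 + x i := by
  set s₁ := (hx 1 one_pos).toFinset with hs₁
  set M := ‖∏ i ∈ s₁, (1 + x i)‖ with hM
  have bound {t : Finset ι} (ht : s₁ ⊆ t) : ‖∏ i ∈ t, (1 + x i)‖ ≤ M := by
    have h := norm_prod_one_add_sub_prod_le ht (x := x) zero_le_one le_rfl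
      fun i hi => by simpa [hs₁] using hi
    rw [one_mul] at h
    calc ‖∏ i ∈ t, (1 + x i)‖
        = ‖(∏ i ∈ t, (1 + x i) - ∏ i ∈ s₁, (1 + x i)) + ∏ i ∈ s₁, (1 + x i)‖ := by
          rw [sub_add_cancel]
      _ ≤ M := (IsUltrametricDist.norm_add_le_max _ _).trans (max_le h le_rfl)
  have hcauchy : CauchySeq fun t : Finset ι => ∏ i ∈ t, (1 + x i) := by
    refine Metric.cauchySeq_iff'.2 fun ε hε => ?_
    set δ := min 1 (ε / (M + 1)) with hδ
    have hM₀ : 0 ≤ M := norm_nonneg _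
    have hδ₀ : 0 < δ := lt_min one_pos (by positivity)
    set s := (hx δ hδ₀).toFinset with hs
    have hss : s₁ ⊆ s := fun i hi => by
      simp only [hs₁, hs, Set.Finite.mem_toFinset, Set.mem_ofPred_eq] at hi ⊢
      exact (min_le_left _ _).trans_lt hi
    refine ⟨s, fun t ht => ?_⟩
    rw [dist_eq_norm]
    calc _ ≤ δ * ‖∏ i ∈ s, (1 + x i)‖ :=
          norm_prod_one_add_sub_prod_le ht hδ₀.le (min_le_left _ _)
            fun i hi => by simpa [hs] using hi
      _ ≤ ε / (M + 1) * M := by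
          gcongr
          · exact min_le_right _ _
          · exact bound hss
      _ < ε := by
          rw [div_mul_eq_mul_div, div_lt_iff₀ (by positivity)]
          nlinarith
  obtain ⟨a, ha⟩ := cauchySeq_tendsto_of_complete hcauchy
  exact ⟨a, ha⟩

theorem norm_tprod_one_add_sub_prod_le {s : Finset ι} {x : ι → C} {r : ℝ} (hr₀ : 0 ≤ r)
    (hr₁ : r ≤ 1) (hx : ∀ i ∉ s, ‖x i‖ ≤ r) (hm : Multipliable fun i => 1 + x i) :
    ‖∏' i, (1 + x i) - ∏ i ∈ s, (1 + x i)‖ ≤ r * ‖∏ i ∈ s, (1 + x i)‖ := by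
  have hlim : Filter.Tendsto (fun t : Finset ι => ∏ i ∈ t, (1 + x i)) Filter.atTop
    (nhds (∏' i, (1 + x i))) := hm.hasProd
  refine le_of_tendsto (hlim.sub_const _).norm ?_
  filter_upwards [Filter.eventually_ge_atTop s] with t ht
  exact norm_prod_one_add_sub_prod_le ht hr₀ hr₁ hx

end Ultrametric

theorem list_prod_one_add_div {C ι : Type*} [Field C] (l : List ι) (K : C) {g : ι → C}
    (hg : ∀ i ∈ l, g i ≠ 0) :
    (l.map fun i => 1 + K / g i).prod * (l.map g).prod = (l.map fun i => K + g i).prod := by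
  induction l with
  | nil => simp
  | cons i l ih =>
    have hi : g i ≠ 0 := hg i List.mem_cons_self
    simp only [List.map_cons, List.prod_cons]
    rw [← ih fun j hj => hg j (List.mem_cons_of_mem i hj)]
    field_simp
    ring

/-! ### Absolute values of polynomials and of elements of `𝔽₄[T]` -/

theorem absK2_Tel2 : absK2 Tel2 = 2 := by
  have h : Tel2 ≠ 0 := HahnSeries.single_ne_zero one_ne_zero
  rw [absK2, if_neg h, Tel2, HahnSeries.order_single one_ne_zero]
  norm_num

theorem polyEmb2_X (C : Type*) [NormedField C] [Algebra (LaurentSeries (ZMod 2)) C] :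
    polyEmb2 C X = algebraMap (LaurentSeries (ZMod 2)) C Tel2 := by
  simp [polyEmb2]

theorem norm_eq_one_of_quadratic {C : Type*} [NormedField C] {ρ : C}
    (hρ : ρ ^ 2 + ρ + 1 = 0) : ‖ρ‖ = 1 := by
  have h : ρ ^ 3 = 1 := by linear_combination (ρ - 1) * hρ
  have h' : ‖ρ‖ ^ 3 = 1 := by rw [← norm_pow, h, norm_one]
  exact (pow_eq_one_iff_of_nonneg (norm_nonneg _) three_ne_zero).1 h'

section Norm

variable {C : Type*} [NormedField C] [Algebra (LaurentSeries (ZMod 2)) C]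

theorem two_eq_zero_of_algebra : (2 : C) = 0 := by
  have h : (2 : (ZMod 2)[X]) = 0 := CharP.cast_eq_zero _ 2
  rw [← map_ofNat (polyEmb2 C) 2, h, map_zero]

variable [IsUltrametricDist C]

theorem norm_polyEmb2 (hT : ‖polyEmb2 C X‖ = 2) {P : (ZMod 2)[X]} (hP : P ≠ 0) :
    ‖polyEmb2 C P‖ = 2 ^ P.natDegree := by
  induction hn : P.natDegree generalizing P with
  | zero =>
    obtain ⟨t, rfl⟩ := Polynomial.natDegree_eq_zero.1 hn
    obtain rfl : t = 1 := by
      refine (zmod_two_eq_zero_or_one t).resolve_left ?_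
      rintro rfl
      simp at hP
    simp
  | succ n ih =>
    have hdeg : P.divX.natDegree = n := by
      rw [Polynomial.natDegree_divX_eq_natDegree_tsub_one, hn, Nat.add_sub_cancel]
    have hne : P.divX ≠ 0 := by
      intro h0
      rw [Polynomial.divX_eq_zero_iff] at h0
      rw [h0, Polynomial.natDegree_C] at hn
      omega
    have hmain : ‖polyEmb2 C (P.divX * X)‖ = 2 ^ (n + 1) := by
      rw [map_mul, norm_mul, hT, ih hne hdeg, pow_succ]
    have hconst : ‖polyEmb2 C (Polynomial.C (P.coeff 0))‖ ≤ 1 := by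
      rcases zmod_two_eq_zero_or_one (P.coeff 0) with h | h <;> simp [h]
    have hlt : ‖polyEmb2 C (Polynomial.C (P.coeff 0))‖ < ‖polyEmb2 C (P.divX * X)‖ := by
      rw [hmain]
      exact hconst.trans_lt (one_lt_pow₀ one_lt_two n.succ_ne_zero)
    conv_lhs => rw [← Polynomial.divX_mul_X_add P, map_add]
    rw [IsUltrametricDist.norm_add_eq_max_of_norm_ne_norm hlt.ne', max_eq_left hlt.le, hmain]

theorem norm_polyEmb2_lt_iff (hT : ‖polyEmb2 C X‖ = 2) {P : (ZMod 2)[X]} {k : ℕ} :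
    ‖polyEmb2 C P‖ < 2 ^ k ↔ P.degree < k := by
  rcases eq_or_ne P 0 with rfl | hP
  · simp
  · rw [norm_polyEmb2 hT hP, pow_lt_pow_iff_right₀ one_lt_two,
      Polynomial.natDegree_lt_iff_degree_lt hP]

theorem norm_polyEmb2_ofBits_lt_iff (hT : ‖polyEmb2 C X‖ = 2) {n k : ℕ} :
    ‖polyEmb2 C (ofBits n)‖ < 2 ^ k ↔ n < 2 ^ k :=
  (norm_polyEmb2_lt_iff hT).trans degree_ofBits_lt_iff

theorem exists_ofBits_eq (hT : ‖polyEmb2 C X‖ = 2) {P : (ZMod 2)[X]} {k : ℕ}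
    (h : ‖polyEmb2 C P‖ < 2 ^ k) : ∃ n < 2 ^ k, ofBits n = P :=
  exists_ofBits_eq_of_degree_lt ((norm_polyEmb2_lt_iff hT).1 h)

theorem finite_norm_polyEmb2_lt (hT : ‖polyEmb2 C X‖ = 2) (k : ℕ) :
    {P : (ZMod 2)[X] | ‖polyEmb2 C P‖ < 2 ^ k}.Finite := by
  refine ((Set.finite_Iio (2 ^ k)).image ofBits).subset fun P hP => ?_
  obtain ⟨n, hn, rfl⟩ := exists_ofBits_eq hT hP
  exact ⟨n, hn, rfl⟩

/-- The element `P ρ + Q`, for polynomials `P` and `Q`. -/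
noncomputable def quadEmb (ρ : C) (P Q : (ZMod 2)[X]) : C := polyEmb2 C P * ρ + polyEmb2 C Q

theorem norm_quadEmb (hT : ‖polyEmb2 C X‖ = 2) {ρ : C} (hρ : ρ ^ 2 + ρ + 1 = 0)
    (P Q : (ZMod 2)[X]) : ‖quadEmb ρ P Q‖ = max ‖polyEmb2 C P‖ ‖polyEmb2 C Q‖ := by
  have hρ₁ := norm_eq_one_of_quadratic hρ
  have hPρ : ‖polyEmb2 C P * ρ‖ = ‖polyEmb2 C P‖ := by rw [norm_mul, hρ₁, mul_one]
  by_cases hPQ : ‖polyEmb2 C P‖ = ‖polyEmb2 C Q‖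
  · rcases eq_or_ne P 0 with rfl | hP
    · simp [quadEmb]
    · have hQ : Q ≠ 0 := by
        rintro rfl
        rw [norm_polyEmb2 hT hP, map_zero, norm_zero] at hPQ
        exact pow_ne_zero _ two_ne_zero hPQ
      have hdeg : P.natDegree = Q.natDegree := by
        rw [norm_polyEmb2 hT hP, norm_polyEmb2 hT hQ] at hPQ
        exact pow_right_injective₀ two_pos (by norm_num) hPQ
      have hlead : ∀ R : (ZMod 2)[X], R ≠ 0 → R.leadingCoeff = 1 := fun R hR =>
        (zmod_two_eq_zero_or_one _).resolve_left (Polynomial.leadingCoeff_ne_zero.2 hR)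
      have hlt : ‖polyEmb2 C (Q - P)‖ < ‖polyEmb2 C P‖ := by
        rw [norm_polyEmb2 hT hP, norm_polyEmb2_lt_iff hT, ← Polynomial.degree_eq_natDegree hP]
        have hd : Q.degree = P.degree := by
          rw [Polynomial.degree_eq_natDegree hP, Polynomial.degree_eq_natDegree hQ, hdeg]
        rw [← hd]
        exact Polynomial.degree_sub_lt_left hd hQ (by rw [hlead P hP, hlead Q hQ])
      have hsum : ‖polyEmb2 C P * (ρ + 1)‖ = ‖polyEmb2 C P‖ := by
        rw [norm_mul, show ρ + 1 = -ρ ^ 2 by linear_combination hρ, norm_neg, norm_pow, hρ₁,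
          one_pow, mul_one]
      rw [quadEmb, show polyEmb2 C P * ρ + polyEmb2 C Q =
        polyEmb2 C P * (ρ + 1) + polyEmb2 C (Q - P) by rw [map_sub]; ring,
        IsUltrametricDist.norm_add_eq_max_of_norm_ne_norm (by rw [hsum]; exact hlt.ne'), hsum,
        max_eq_left hlt.le, ← hPQ, max_self]
  · rw [quadEmb, IsUltrametricDist.norm_add_eq_max_of_norm_ne_norm (by rwa [hPρ]), hPρ]

theorem quadEmb_ne_zero (hT : ‖polyEmb2 C X‖ = 2) {ρ : C} (hρ : ρ ^ 2 + ρ + 1 = 0)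
    {P Q : (ZMod 2)[X]} (h : P ≠ 0 ∨ Q ≠ 0) : quadEmb ρ P Q ≠ 0 := by
  rw [← norm_pos_iff, norm_quadEmb hT hρ, lt_max_iff]
  refine h.imp (fun h => ?_) fun h => ?_ <;> rw [norm_polyEmb2 hT h] <;> positivity

theorem exists_norm_quadEmb_eq (hT : ‖polyEmb2 C X‖ = 2) {ρ : C} (hρ : ρ ^ 2 + ρ + 1 = 0)
    {P Q : (ZMod 2)[X]} (h : P ≠ 0 ∨ Q ≠ 0) : ∃ n : ℕ, ‖quadEmb ρ P Q‖ = 2 ^ n := by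
  have h₀ := norm_pos_iff.2 (quadEmb_ne_zero hT hρ h)
  rw [norm_quadEmb hT hρ] at h₀ ⊢
  have key : ∀ R : (ZMod 2)[X], 0 < ‖polyEmb2 C R‖ → ∃ n : ℕ, ‖polyEmb2 C R‖ = 2 ^ n :=
    fun R hR => ⟨_, norm_polyEmb2 hT (by rintro rfl; simp at hR)⟩
  rcases max_choice ‖polyEmb2 C P‖ ‖polyEmb2 C Q‖ with hm | hm <;> rw [hm] at h₀ ⊢ <;>
    exact key _ h₀

end Norm

/-! ### The factors of the product -/

/-- `(X³ · alphaLeft u v, alphaRight u v)` is the row `(X³ · u, v)` times `α`. -/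
noncomputable def alphaLeft (u v : (ZMod 2)[X]) : (ZMod 2)[X] := (X ^ 2 + X + 1) * u + v

/-- `(X³ · alphaLeft u v, alphaRight u v)` is the row `(X³ · u, v)` times `α`. -/
noncomputable def alphaRight (u v : (ZMod 2)[X]) : (ZMod 2)[X] := X ^ 3 * u + (X + 1) * v

/-- For `γ = [[a, b], [X³ · c, d]]`, the lower left entry of `α⁻¹γα` is
`X³ · conjLeft a b c d`. -/
noncomputable def conjLeft (a b c d : (ZMod 2)[X]) : (ZMod 2)[X] :=
  alphaLeft (a + (X ^ 2 + X + 1) * c) (X ^ 3 * b + (X ^ 2 + X + 1) * d)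

/-- For `γ = [[a, b], [X³ · c, d]]`, the lower right entry of `α⁻¹γα` is
`conjRight a b c d`. -/
noncomputable def conjRight (a b c d : (ZMod 2)[X]) : (ZMod 2)[X] :=
  alphaRight (a + (X ^ 2 + X + 1) * c) (X ^ 3 * b + (X ^ 2 + X + 1) * d)

theorem two_eq_zero_polynomial : (2 : (ZMod 2)[X]) = 0 := CharP.cast_eq_zero _ 2

theorem alpha_injective {u v u' v' : (ZMod 2)[X]} (h₁ : alphaLeft u v = alphaLeft u' v')
    (h₂ : alphaRight u v = alphaRight u' v') : u = u' ∧ v = v' := by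
  simp only [alphaLeft, alphaRight] at h₁ h₂
  have hu : u = u' := by
    linear_combination (X + 1) * h₁ - h₂ - (X ^ 2 + X) * (u - u') * two_eq_zero_polynomial
  subst hu
  exact ⟨rfl, by linear_combination h₁⟩

theorem alpha_ne_zero {u v : (ZMod 2)[X]} (h : u ≠ 0 ∨ v ≠ 0) :
    alphaLeft u v ≠ 0 ∨ alphaRight u v ≠ 0 := by
  by_contra! h'
  obtain ⟨rfl, rfl⟩ := alpha_injective (u' := 0) (v' := 0)
    (h'.1.trans (by simp [alphaLeft])) (h'.2.trans (by simp [alphaRight]))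
  simp at h

theorem conj_ne_zero {a b c d : (ZMod 2)[X]} (h : a * d - b * (X ^ 3 * c) = 1) :
    conjLeft a b c d ≠ 0 ∨ conjRight a b c d ≠ 0 := by
  refine alpha_ne_zero ?_
  by_contra! h'
  refine one_ne_zero (α := (ZMod 2)[X]) ?_
  linear_combination d * h'.1 - c * h'.2 - h

theorem upperRow_eq_of_conj_eq {a b a' b' c d : (ZMod 2)[X]}
    (h₁ : conjLeft a b c d = conjLeft a' b' c d) (h₂ : conjRight a b c d = conjRight a' b' c d) :
    a = a' ∧ b = b' := by
  obtain ⟨ha, hb⟩ := alpha_injective h₁ h₂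
  exact ⟨add_right_cancel ha,
    mul_left_cancel₀ (pow_ne_zero 3 Polynomial.X_ne_zero) (add_right_cancel hb)⟩

theorem conj_mul_alpha {a b c d : (ZMod 2)[X]} (h : a * d - b * (X ^ 3 * c) = 1) :
    conjLeft a b c d * alphaRight c d = conjRight a b c d * alphaLeft c d + 1 := by
  simp only [conjLeft, conjRight, alphaLeft, alphaRight]
  linear_combination (1 + 2 * X + 2 * X ^ 2) * h + (X + X ^ 2) * two_eq_zero_polynomial

theorem conjRight_eq (a b c d : (ZMod 2)[X]) :
    conjRight a b c d = (X ^ 2 + X + 1) * alphaRight c d + X ^ 3 * (a + (X + 1) * b) := by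
  simp only [conjRight, alphaRight]
  ring

/-- The polynomial `c` for which the lower left entry of `γ` is `X³ · c`. -/
noncomputable def lowLeft (γ : Gamma0T3) : (ZMod 2)[X] := γ.2.2.choose

theorem lowLeft_spec (γ : Gamma0T3) : γ.val 1 0 = X ^ 3 * lowLeft γ := γ.2.2.choose_spec

theorem det_eq_one (γ : Gamma0T3) :
    γ.val 0 0 * γ.val 1 1 - γ.val 0 1 * (X ^ 3 * lowLeft γ) = 1 := by
  rw [← lowLeft_spec, ← Matrix.det_fin_two]
  exact γ.2.1

theorem lowLeft_ne_zero (γ : Gamma0T3) : lowLeft γ ≠ 0 ∨ γ.val 1 1 ≠ 0 := by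
  by_contra! h
  have := det_eq_one γ
  simp [h.1, h.2] at this

theorem X_mul_ne_zero_or {P Q : (ZMod 2)[X]} (h : P ≠ 0 ∨ Q ≠ 0) : X * P ≠ 0 ∨ Q ≠ 0 :=
  h.imp_left (mul_ne_zero Polynomial.X_ne_zero)

/-- The polynomial `conjLeft` of the entries of `γ`. -/
noncomputable def gammaLeft (γ : Gamma0T3) : (ZMod 2)[X] :=
  conjLeft (γ.val 0 0) (γ.val 0 1) (lowLeft γ) (γ.val 1 1)

/-- The polynomial `conjRight` of the entries of `γ`. -/
noncomputable def gammaRight (γ : Gamma0T3) : (ZMod 2)[X] :=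
  conjRight (γ.val 0 0) (γ.val 0 1) (lowLeft γ) (γ.val 1 1)

theorem gamma_ext {γ δ : Gamma0T3} (h₁ : lowLeft γ = lowLeft δ) (h₂ : γ.val 1 1 = δ.val 1 1)
    (h₃ : gammaLeft γ = gammaLeft δ) (h₄ : gammaRight γ = gammaRight δ) : γ = δ := by
  simp only [gammaLeft, gammaRight, ← h₁, ← h₂] at h₃ h₄
  obtain ⟨ha, hb⟩ := upperRow_eq_of_conj_eq h₃ h₄
  refine Subtype.ext (Matrix.ext fun i j => ?_)
  fin_cases i <;> fin_cases j
  · exact ha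
  · exact hb
  · exact (lowLeft_spec γ).trans (h₁ ▸ (lowLeft_spec δ).symm)
  · exact h₂

section Factor

variable {C : Type*} [NormedField C] [Algebra (LaurentSeries (ZMod 2)) C]

/-- The denominator of `γω`. -/
noncomputable def lowVal (ρ : C) (γ : Gamma0T3) : C := quadEmb ρ (X * lowLeft γ) (γ.val 1 1)

/-- The denominator of `α⁻¹γαω`. -/
noncomputable def conjVal (ρ : C) (γ : Gamma0T3) : C :=
  quadEmb ρ (X * gammaLeft γ) (gammaRight γ)

/-- The constant `K` for which the factor of the product at `γ` is
`1 + K / (lowVal ρ γ * conjVal ρ γ)`. -/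
noncomputable def crossConst (ρ : C) : C := quadEmb ρ (X ^ 3 + X ^ 2) (X ^ 3 + X ^ 2)

variable [IsUltrametricDist C]

theorem lowVal_ne_zero (hT : ‖polyEmb2 C X‖ = 2) {ρ : C} (hρ : ρ ^ 2 + ρ + 1 = 0)
    (γ : Gamma0T3) : lowVal ρ γ ≠ 0 :=
  quadEmb_ne_zero hT hρ (X_mul_ne_zero_or (lowLeft_ne_zero γ))

theorem conjVal_ne_zero (hT : ‖polyEmb2 C X‖ = 2) {ρ : C} (hρ : ρ ^ 2 + ρ + 1 = 0)
    (γ : Gamma0T3) : conjVal ρ γ ≠ 0 :=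
  quadEmb_ne_zero hT hρ (X_mul_ne_zero_or (conj_ne_zero (det_eq_one γ)))

theorem norm_crossConst (hT : ‖polyEmb2 C X‖ = 2) {ρ : C} (hρ : ρ ^ 2 + ρ + 1 = 0) :
    ‖crossConst ρ‖ = 8 := by
  have h : (X ^ 3 + X ^ 2 : (ZMod 2)[X]).natDegree = 3 := by compute_degree!
  have h₀ : (X ^ 3 + X ^ 2 : (ZMod 2)[X]) ≠ 0 := by
    intro h₀; simp [h₀] at h
  rw [crossConst, norm_quadEmb hT hρ, max_self, norm_polyEmb2 hT h₀, h]
  norm_num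

theorem factor_eq (hT : ‖polyEmb2 C X‖ = 2) {ρ : C} (hρ : ρ ^ 2 + ρ + 1 = 0)
    {ω : C} (hω : ω = (polyEmb2 C X)⁻¹ ^ 2 * ρ) {r : C}
    (hr : r = polyEmb2 C (X ^ 2 + X + 1) / polyEmb2 C (X ^ 3)) (γ : Gamma0T3) :
    (r - act2 γ.val ω) / (r - act2 γ.val (act2 alpha2 ω)) =
      1 + crossConst ρ / (lowVal ρ γ * conjVal ρ γ) := by
  have h2 : (2 : C) = 0 := two_eq_zero_of_algebra
  have hV := lowVal_ne_zero hT hρ γ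
  have hW := conjVal_ne_zero hT hρ γ
  have hD : quadEmb ρ (X * 1) (X + 1) ≠ 0 :=
    quadEmb_ne_zero hT hρ (X_mul_ne_zero_or (Or.inl one_ne_zero))
  have hV' : quadEmb ρ (X * alphaLeft (lowLeft γ) (γ.val 1 1))
      (alphaRight (lowLeft γ) (γ.val 1 1)) ≠ 0 :=
    quadEmb_ne_zero hT hρ (X_mul_ne_zero_or (alpha_ne_zero (lowLeft_ne_zero γ)))
  have hdet := congrArg (polyEmb2 C) (det_eq_one γ)
  have ht : polyEmb2 C X ≠ 0 := by
    rw [← norm_pos_iff, hT]; exact two_pos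
  have hρω : ρ = polyEmb2 C X ^ 2 * ω := by
    rw [hω]; field_simp
  simp only [act2, lowLeft_spec, alpha2, lowVal, conjVal, crossConst, gammaLeft, gammaRight,
    conjLeft, conjRight, alphaLeft, alphaRight, quadEmb, map_add, map_mul, map_sub, map_pow,
    map_one, Matrix.of_apply, Matrix.cons_val', Matrix.cons_val_zero, Matrix.cons_val_one,
    Matrix.cons_val_fin_one, mul_one] at *
  generalize polyEmb2 C X = t at *
  generalize polyEmb2 C (γ.val 0 0) = a at *
  generalize polyEmb2 C (γ.val 0 1) = b at *
  generalize polyEmb2 C (lowLeft γ) = c at *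
  generalize polyEmb2 C (γ.val 1 1) = d at *
  clear hω
  subst hρω
  generalize hp : t ^ 2 + t + 1 = p at *
  have ht3 : t ^ 3 ≠ 0 := pow_ne_zero 3 ht
  have hlow : t ^ 3 * c * ω + d ≠ 0 := fun h => hV (by linear_combination h)
  have hα : t ^ 3 * ω + (1 + t) ≠ 0 := fun h => hD (by linear_combination h)
  have hlow' : t ^ 3 * c * (p * ω + 1) + d * (t ^ 3 * ω + (1 + t)) ≠ 0 :=
    fun h => hV' (by linear_combination h)
  have hnum : r - (a * ω + b) / (t ^ 3 * c * ω + d) =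
      (t * (a + p * c) * (t ^ 2 * ω) + (t ^ 3 * b + p * d)) /
        (t ^ 3 * (t ^ 3 * c * ω + d)) := by
    rw [hr, div_sub_div _ _ ht3 hlow]
    congr 1
    linear_combination -(t ^ 3 * (a * ω + b)) * h2
  have hαω : (a * ((p * ω + 1) / (t ^ 3 * ω + (1 + t))) + b) /
      (t ^ 3 * c * ((p * ω + 1) / (t ^ 3 * ω + (1 + t))) + d) =
      (a * (p * ω + 1) + b * (t ^ 3 * ω + (1 + t))) /
        (t ^ 3 * c * (p * ω + 1) + d * (t ^ 3 * ω + (1 + t))) := by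
    rw [← mul_div_mul_right _ _ hα, add_mul, add_mul, mul_assoc a, mul_assoc (t ^ 3 * c),
      div_mul_cancel₀ _ hα]
  have hden : r - (a * (p * ω + 1) + b * (t ^ 3 * ω + (1 + t))) /
        (t ^ 3 * c * (p * ω + 1) + d * (t ^ 3 * ω + (1 + t))) =
      (t * (p * (a + p * c) + (t ^ 3 * b + p * d)) * (t ^ 2 * ω) +
          (t ^ 3 * (a + p * c) + (t + 1) * (t ^ 3 * b + p * d))) /
        (t ^ 3 * (t ^ 3 * c * (p * ω + 1) + d * (t ^ 3 * ω + (1 + t)))) := by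
    rw [hr, div_sub_div _ _ ht3 hlow']
    congr 1
    linear_combination -(t ^ 3 * (a * (p * ω + 1) + b * (t ^ 3 * ω + (1 + t)))) * h2
  have hkey : (t * (a + p * c) * (t ^ 2 * ω) + (t ^ 3 * b + p * d)) *
      (t ^ 3 * c * (p * ω + 1) + d * (t ^ 3 * ω + (1 + t))) =
      (t * c * (t ^ 2 * ω) + d) *
        (t * (p * (a + p * c) + (t ^ 3 * b + p * d)) * (t ^ 2 * ω) +
          (t ^ 3 * (a + p * c) + (t + 1) * (t ^ 3 * b + p * d))) +
        ((t ^ 3 + t ^ 2) * (t ^ 2 * ω) + (t ^ 3 + t ^ 2)) := by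
    subst hp
    linear_combination (t ^ 2 * (t ^ 2 * ω) ^ 2 - t ^ 3 * (t ^ 2 * ω) - t ^ 3) * hdet + t ^ 2 * hρ
      - ((t ^ 3 + t ^ 2) * (t ^ 2 * ω) + (t ^ 3 + t ^ 2)) * h2
  rw [hnum, hαω, hden, div_div_div_eq, one_add_div (mul_ne_zero hV hW),
    div_eq_div_iff (mul_ne_zero (mul_ne_zero ht3 hlow) hW) (mul_ne_zero hV hW)]
  linear_combination (t ^ 3 * (t * c * (t ^ 2 * ω) + d) *
    (t * (p * (a + p * c) + (t ^ 3 * b + p * d)) * (t ^ 2 * ω) +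
      (t ^ 3 * (a + p * c) + (t + 1) * (t ^ 3 * b + p * d)))) * hkey

end Factor

/-! ### The elements of `Γ` whose factor is not close to `1` -/

/-- `alphaLeft` on binary expansions. -/
def bitAlphaLeft (u v : ℕ) : ℕ := Nat.xor (bitMul 7 u) v

/-- `alphaRight` on binary expansions. -/
def bitAlphaRight (u v : ℕ) : ℕ := Nat.xor (8 * u) (bitMul 3 v)

/-- `conjLeft` on binary expansions. -/
def bitConjLeft (a b c d : ℕ) : ℕ :=
  bitAlphaLeft (Nat.xor a (bitMul 7 c)) (Nat.xor (8 * b) (bitMul 7 d))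

/-- `conjRight` on binary expansions. -/
def bitConjRight (a b c d : ℕ) : ℕ :=
  bitAlphaRight (Nat.xor a (bitMul 7 c)) (Nat.xor (8 * b) (bitMul 7 d))

theorem ofBits_bitAlphaLeft (u v : ℕ) :
    ofBits (bitAlphaLeft u v) = alphaLeft (ofBits u) (ofBits v) := by
  rw [bitAlphaLeft, ofBits_xor, ofBits_bitMul, ofBits_seven, alphaLeft]

theorem ofBits_bitAlphaRight (u v : ℕ) :
    ofBits (bitAlphaRight u v) = alphaRight (ofBits u) (ofBits v) := by
  rw [bitAlphaRight, ofBits_xor, ofBits_bitMul, ofBits_eight_mul, ofBits_three, alphaRight]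

theorem ofBits_bitConjLeft (a b c d : ℕ) :
    ofBits (bitConjLeft a b c d) = conjLeft (ofBits a) (ofBits b) (ofBits c) (ofBits d) := by
  simp only [bitConjLeft, conjLeft, ofBits_bitAlphaLeft, ofBits_xor, ofBits_bitMul,
    ofBits_eight_mul, ofBits_seven]

theorem ofBits_bitConjRight (a b c d : ℕ) :
    ofBits (bitConjRight a b c d) = conjRight (ofBits a) (ofBits b) (ofBits c) (ofBits d) := by
  simp only [bitConjRight, conjRight, ofBits_bitAlphaRight, ofBits_xor, ofBits_bitMul,
    ofBits_eight_mul, ofBits_seven]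

/-- Binary expansions of `(a, b, c, d)` for the matrices `[[a, b], [X³ · c, d]]` in `Γ` at which
the product of `lowVal` and `conjVal` has absolute value at most `2 ^ 7`. -/
@[irreducible] def cosetCodes : List (ℕ × ℕ × ℕ × ℕ) :=
  [(1, 9, 0, 1), (1, 8, 0, 1), (1, 11, 0, 1), (1, 5, 0, 1), (1, 6, 0, 1),
   (1, 7, 0, 1), (1, 2, 0, 1), (1, 3, 0, 1), (1, 1, 0, 1), (1, 4, 0, 1),
   (1, 14, 0, 1), (1, 15, 0, 1), (1, 10, 0, 1), (1, 0, 0, 1), (1, 12, 0, 1),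
   (1, 13, 0, 1), (1, 0, 1, 1), (9, 1, 1, 1), (7, 1, 1, 3), (15, 2, 1, 3),
   (5, 2, 1, 5), (13, 7, 1, 5), (3, 1, 1, 7), (11, 6, 1, 7), (19, 15, 1, 7),
   (27, 8, 1, 7), (35, 29, 1, 7), (43, 26, 1, 7), (51, 19, 1, 7), (59, 20, 1, 7),
   (7, 6, 1, 11), (7, 15, 1, 19), (7, 8, 1, 27), (7, 29, 1, 35), (7, 26, 1, 43),
   (7, 19, 1, 51), (7, 20, 1, 59), (7, 57, 1, 67), (7, 62, 1, 75), (7, 55, 1, 83),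
   (7, 48, 1, 91), (7, 37, 1, 99), (7, 34, 1, 107), (7, 43, 1, 115), (7, 44, 1, 123),
   (15, 1, 2, 3), (11, 3, 2, 7), (9, 4, 2, 9), (13, 5, 2, 13), (3, 1, 2, 15),
   (19, 14, 2, 15), (11, 2, 3, 7), (7, 2, 3, 11), (13, 6, 3, 13), (31, 1, 4, 3),
   (29, 4, 4, 13), (25, 10, 4, 25), (25, 8, 5, 25), (31, 11, 6, 19), (21, 15, 6, 21),
   (19, 11, 6, 31), (23, 1, 7, 3), (57, 21, 8, 57), (55, 6, 10, 11), (49, 16, 10, 49),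
   (51, 22, 11, 63), (37, 13, 12, 21), (43, 16, 14, 55), (41, 24, 15, 41), (113, 42, 16, 113),
   (105, 37, 21, 97), (73, 63, 24, 73), (225, 84, 32, 225), (217, 65, 40, 217), (145, 126, 48, 145),
   (169, 107, 56, 169)]

/-- Whether the matrices listed in `cosetCodes` have determinant one. -/
def cosetCodesDetOne : Bool := cosetCodes.all fun l =>
  Nat.beq (Nat.xor (bitMul l.1 l.2.2.2) (8 * bitMul l.2.1 l.2.2.1)) 1

theorem cosetCodesDetOne_eq_true : cosetCodesDetOne = true := by decide +kernel

theorem nodup_cosetCodes : cosetCodes.Nodup := by decide +kernel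

/-- The matrix with binary expansions `l`. -/
noncomputable def codeMatrix (l : ℕ × ℕ × ℕ × ℕ) : Matrix (Fin 2) (Fin 2) (ZMod 2)[X] :=
  !![ofBits l.1, ofBits l.2.1; X ^ 3 * ofBits l.2.2.1, ofBits l.2.2.2]

theorem codeMatrix_mem {l : ℕ × ℕ × ℕ × ℕ} (hl : l ∈ cosetCodes) : codeMatrix l ∈ Gamma0T3 := by
  refine ⟨?_, Dvd.intro (ofBits l.2.2.1) rfl⟩
  have h := Nat.eq_of_beq_eq_true (List.all_eq_true.1 cosetCodesDetOne_eq_true l hl)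
  have h' := congrArg ofBits h
  rw [ofBits_xor, ofBits_bitMul, ofBits_eight_mul, ofBits_bitMul, ofBits_one] at h'
  rw [codeMatrix, Matrix.det_fin_two_of]
  linear_combination h' - X ^ 3 * ofBits l.2.1 * ofBits l.2.2.1 * two_eq_zero_polynomial

theorem lowLeft_codeMatrix {l : ℕ × ℕ × ℕ × ℕ} (hl : codeMatrix l ∈ Gamma0T3) :
    lowLeft ⟨codeMatrix l, hl⟩ = ofBits l.2.2.1 :=
  mul_left_cancel₀ (pow_ne_zero 3 Polynomial.X_ne_zero)
    (lowLeft_spec ⟨codeMatrix l, hl⟩).symm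

theorem gammaLeft_codeMatrix {l : ℕ × ℕ × ℕ × ℕ} (hl : codeMatrix l ∈ Gamma0T3) :
    gammaLeft ⟨codeMatrix l, hl⟩ = ofBits (bitConjLeft l.1 l.2.1 l.2.2.1 l.2.2.2) := by
  rw [gammaLeft, lowLeft_codeMatrix, ofBits_bitConjLeft]
  rfl

theorem gammaRight_codeMatrix {l : ℕ × ℕ × ℕ × ℕ} (hl : codeMatrix l ∈ Gamma0T3) :
    gammaRight ⟨codeMatrix l, hl⟩ = ofBits (bitConjRight l.1 l.2.1 l.2.2.1 l.2.2.2) := by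
  rw [gammaRight, lowLeft_codeMatrix, ofBits_bitConjRight]
  rfl

/-- The elements of `Γ` listed in `cosetCodes`. -/
noncomputable def cosetList : List Gamma0T3 :=
  cosetCodes.pmap (fun l hl => ⟨codeMatrix l, hl⟩) fun _ => codeMatrix_mem

theorem nodup_cosetList : cosetList.Nodup := by
  refine nodup_cosetCodes.pmap fun l hl l' hl' h => ?_
  have h : codeMatrix l = codeMatrix l' := congrArg Subtype.val h
  have h₁ : ofBits l.1 = ofBits l'.1 := congrFun (congrFun h 0) 0
  have h₂ : ofBits l.2.1 = ofBits l'.2.1 := congrFun (congrFun h 0) 1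
  have h₃ : X ^ 3 * ofBits l.2.2.1 = X ^ 3 * ofBits l'.2.2.1 := congrFun (congrFun h 1) 0
  have h₄ : ofBits l.2.2.2 = ofBits l'.2.2.2 := congrFun (congrFun h 1) 1
  exact Prod.ext (ofBits_injective h₁) (Prod.ext (ofBits_injective h₂)
    (Prod.ext (ofBits_injective (mul_left_cancel₀ (pow_ne_zero 3 Polynomial.X_ne_zero) h₃))
      (ofBits_injective h₄)))

/-- Whether `p` holds at every `m < n`. -/
def allBelow (n : ℕ) (p : ℕ → Bool) : Bool :=
  Nat.rec true (fun m ih => p m && ih) n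

theorem eq_true_of_allBelow {n : ℕ} {p : ℕ → Bool} (h : allBelow n p = true) {m : ℕ}
    (hm : m < n) : p m = true := by
  induction n with
  | zero => omega
  | succ n ih =>
    have h' : p n = true ∧ allBelow n p = true := Bool.and_eq_true_iff.1 h
    rcases Nat.lt_succ_iff_lt_or_eq.1 hm with hm | rfl
    exacts [ih h'.2 hm, h'.1]

/-- Whether some matrix `[[a, b], [X³ · c, d]]` listed in `cosetCodes` has the given `c` and `d`,
`conjLeft` equal to `e` and `conjRight` equal to `f`. -/
def isListed (c d e f : ℕ) : Bool := cosetCodes.any fun l =>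
  Nat.beq l.2.2.1 c && Nat.beq l.2.2.2 d && Nat.beq (bitConjLeft l.1 l.2.1 l.2.2.1 l.2.2.2) e
    && Nat.beq (bitConjRight l.1 l.2.1 l.2.2.1 l.2.2.2) f

/-- Whether `cosetCodes` contains all matrices `[[a, b], [X³ · c, d]]` in `Γ` with
`lowVal` of absolute value at most `2 ^ i` and `conjVal` of absolute value at most `2 ^ (7 - i)`. -/
def levelListed (i : ℕ) : Bool :=
  allBelow (2 ^ i) fun c => allBelow (2 ^ (i + 1)) fun d =>
  evalFirst (bitAlphaLeft c d) fun c' =>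
  evalFirst (bitAlphaRight c d) fun d' =>
  evalFirst (bitMul 7 d' % 8) fun r =>
  allBelow (2 ^ (7 - i)) fun e =>
  evalFirst (Nat.xor (bitMul d' e) 1) fun s =>
  allBelow (2 ^ (5 - i)) fun m =>
  evalFirst (8 * m + r) fun f =>
    !(Nat.beq (bitMul c' f) s && Nat.ble (f + 1) (2 ^ (8 - i))) || isListed c d e f

theorem levelListed_eq_true : allBelow 8 levelListed = true := by decide +kernel

theorem isListed_of_levelListed {i c d e f : ℕ} (hi : levelListed i = true) (hc : c < 2 ^ i)
    (hd : d < 2 ^ (i + 1)) (he : e < 2 ^ (7 - i)) (hf : f < 2 ^ (8 - i))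
    (hmod : f % 8 = bitMul 7 (bitAlphaRight c d) % 8)
    (h : bitMul (bitAlphaLeft c d) f = Nat.xor (bitMul (bitAlphaRight c d) e) 1) :
    isListed c d e f = true := by
  have h₁ := eq_true_of_allBelow (eq_true_of_allBelow hi hc) hd
  simp only [evalFirst_eq] at h₁
  have hm : f / 8 < 2 ^ (5 - i) := by
    rcases le_total i 5 with h5 | h5
    · rw [Nat.div_lt_iff_lt_mul (by norm_num), show 8 = 2 ^ 3 by rfl, ← pow_add,
        show 5 - i + 3 = 8 - i by omega]
      exact hf
    · have : 2 ^ (8 - i) ≤ 2 ^ 3 := Nat.pow_le_pow_right two_pos (by omega)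
      rw [Nat.div_eq_of_lt (by omega)]
      positivity
  have h₂ := eq_true_of_allBelow (eq_true_of_allBelow h₁ he) hm
  rw [← hmod, Nat.div_add_mod, h, Nat.beq_refl, Nat.ble_eq_true_of_le hf] at h₂
  exact h₂

theorem exists_ofBits (P : (ZMod 2)[X]) : ∃ n, ofBits n = P := by
  obtain ⟨n, -, h⟩ := exists_ofBits_eq_of_degree_lt (P := P) (k := P.natDegree + 1)
    (Polynomial.degree_le_natDegree.trans_lt (by exact_mod_cast P.natDegree.lt_succ_self))
  exact ⟨n, h⟩

section Coset

variable {C : Type*} [NormedField C] [Algebra (LaurentSeries (ZMod 2)) C] [IsUltrametricDist C]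

theorem exists_ofBits_of_norm_quadEmb (hT : ‖polyEmb2 C X‖ = 2) {ρ : C}
    (hρ : ρ ^ 2 + ρ + 1 = 0) {P Q : (ZMod 2)[X]} {k : ℕ}
    (h : ‖quadEmb ρ (X * P) Q‖ ≤ 2 ^ k) :
    (∃ m < 2 ^ k, ofBits m = P) ∧ ∃ n < 2 ^ (k + 1), ofBits n = Q := by
  rw [norm_quadEmb hT hρ, max_le_iff, map_mul, norm_mul, hT] at h
  have hk : (0 : ℝ) < 2 ^ k := by positivity
  exact ⟨exists_ofBits_eq hT (by linarith [h.1]),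
    exists_ofBits_eq hT (by rw [pow_succ]; linarith [h.2])⟩

theorem gammaRight_mod_eight {c d f : ℕ} {γ : Gamma0T3} (hc : ofBits c = lowLeft γ)
    (hd : ofBits d = γ.val 1 1) (hf : ofBits f = gammaRight γ) :
    f % 8 = bitMul 7 (bitAlphaRight c d) % 8 := by
  obtain ⟨m, hm⟩ := exists_ofBits (γ.val 0 0 + (X + 1) * γ.val 0 1)
  have h : f = Nat.xor (bitMul 7 (bitAlphaRight c d)) (8 * m) := by
    apply ofBits_injective
    rw [ofBits_xor, ofBits_bitMul, ofBits_seven, ofBits_bitAlphaRight, ofBits_eight_mul, hc, hd,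
      hm, hf, gammaRight, conjRight_eq]
  have h8 := Nat.xor_mod_two_pow (a := bitMul 7 (bitAlphaRight c d)) (b := 8 * m) (n := 3)
  rw [h]
  refine h8.trans ?_
  simp

theorem mem_cosetList (hT : ‖polyEmb2 C X‖ = 2) {ρ : C} (hρ : ρ ^ 2 + ρ + 1 = 0)
    {γ : Gamma0T3} (h : ‖lowVal ρ γ‖ * ‖conjVal ρ γ‖ ≤ 2 ^ 7) : γ ∈ cosetList := by
  obtain ⟨i, hi⟩ := exists_norm_quadEmb_eq hT hρ (X_mul_ne_zero_or (lowLeft_ne_zero γ))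
  obtain ⟨j, hj⟩ := exists_norm_quadEmb_eq hT hρ (X_mul_ne_zero_or (conj_ne_zero (det_eq_one γ)))
  have hij : i + j ≤ 7 := by
    rw [lowVal, conjVal, hi, gammaLeft, gammaRight, hj, ← pow_add] at h
    exact (pow_le_pow_iff_right₀ one_lt_two).1 h
  have hj' : (2 : ℝ) ^ j ≤ 2 ^ (7 - i) := pow_le_pow_right₀ one_le_two (by omega)
  obtain ⟨⟨c, hc, hc'⟩, d, hd, hd'⟩ := exists_ofBits_of_norm_quadEmb hT hρ hi.le
  obtain ⟨⟨e, he, he'⟩, f, hf, hf'⟩ := exists_ofBits_of_norm_quadEmb hT hρ (hj.trans_le hj')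
  rw [show 7 - i + 1 = 8 - i by omega] at hf
  have hmul : bitMul (bitAlphaLeft c d) f = Nat.xor (bitMul (bitAlphaRight c d) e) 1 := by
    apply ofBits_injective
    rw [ofBits_xor, ofBits_bitMul, ofBits_bitMul, ofBits_bitAlphaLeft, ofBits_bitAlphaRight,
      ofBits_one, hc', hd', he', hf']
    linear_combination -conj_mul_alpha (det_eq_one γ) - two_eq_zero_polynomial
  have hlisted := isListed_of_levelListed
    (eq_true_of_allBelow levelListed_eq_true (m := i) (by omega)) hc hd he hf
    (gammaRight_mod_eight hc' hd' hf') hmul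
  obtain ⟨l, hl, hl'⟩ := List.any_eq_true.1 hlisted
  simp only [Bool.and_eq_true, Nat.beq_eq] at hl'
  obtain ⟨⟨⟨rfl, rfl⟩, rfl⟩, rfl⟩ := hl'
  refine List.mem_pmap.2 ⟨l, hl, gamma_ext ?_ hd' ?_ ?_⟩
  · rw [lowLeft_codeMatrix, hc']
  · rw [gammaLeft_codeMatrix, he', gammaLeft]
  · rw [gammaRight_codeMatrix, hf', gammaRight]

theorem norm_factor_le_of_notMem (hT : ‖polyEmb2 C X‖ = 2) {ρ : C} (hρ : ρ ^ 2 + ρ + 1 = 0)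
    {γ : Gamma0T3} (h : γ ∉ cosetList) :
    ‖crossConst ρ / (lowVal ρ γ * conjVal ρ γ)‖ ≤ 1 / 32 := by
  obtain ⟨i, hi⟩ := exists_norm_quadEmb_eq hT hρ (X_mul_ne_zero_or (lowLeft_ne_zero γ))
  obtain ⟨j, hj⟩ := exists_norm_quadEmb_eq hT hρ (X_mul_ne_zero_or (conj_ne_zero (det_eq_one γ)))
  have h' := mt (mem_cosetList hT hρ) h
  rw [norm_div, norm_mul, norm_crossConst hT hρ]
  rw [lowVal, conjVal, hi, gammaLeft, gammaRight, hj, ← pow_add] at h' ⊢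
  have hij : 8 ≤ i + j := by
    by_contra! hlt
    exact h' (pow_le_pow_right₀ one_le_two (by omega))
  rw [div_le_div_iff₀ (by positivity) (by norm_num)]
  linarith [pow_le_pow_right₀ (one_le_two (α := ℝ)) hij]

theorem finite_lt_norm_factor (hT : ‖polyEmb2 C X‖ = 2) {ρ : C} (hρ : ρ ^ 2 + ρ + 1 = 0)
    {ε : ℝ} (hε : 0 < ε) :
    {γ : Gamma0T3 | ε < ‖crossConst ρ / (lowVal ρ γ * conjVal ρ γ)‖}.Finite := by
  obtain ⟨k, hk⟩ := pow_unbounded_of_one_lt (8 / ε) (one_lt_two (α := ℝ))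
  have hfin := finite_norm_polyEmb2_lt hT k
  refine Set.Finite.of_finite_image (f := fun γ : Gamma0T3 =>
      (lowLeft γ, γ.val 1 1, gammaLeft γ, gammaRight γ))
    ((hfin.prod (hfin.prod (hfin.prod hfin))).subset ?_) ?_
  · rintro _ ⟨γ, hγ, rfl⟩
    obtain ⟨i, hi⟩ := exists_norm_quadEmb_eq hT hρ (X_mul_ne_zero_or (lowLeft_ne_zero γ))
    obtain ⟨j, hj⟩ :=
      exists_norm_quadEmb_eq hT hρ (X_mul_ne_zero_or (conj_ne_zero (det_eq_one γ)))
    have h₁ : (1 : ℝ) ≤ 2 ^ i := one_le_pow₀ one_le_two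
    have h₂ : (1 : ℝ) ≤ 2 ^ j := one_le_pow₀ one_le_two
    have hlt : (2 : ℝ) ^ i * 2 ^ j < 2 ^ k := by
      rw [Set.mem_ofPred_eq, norm_div, norm_mul, norm_crossConst hT hρ, lowVal, conjVal, hi,
        gammaLeft, gammaRight, hj, lt_div_iff₀ (by positivity)] at hγ
      rw [div_lt_iff₀ hε] at hk
      nlinarith
    have h₃ : (2 : ℝ) ^ i < 2 ^ k := (le_mul_of_one_le_right (by positivity) h₂).trans_lt hlt
    have h₄ : (2 : ℝ) ^ j < 2 ^ k := (le_mul_of_one_le_left (by positivity) h₁).trans_lt hlt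
    rw [← hi, norm_quadEmb hT hρ, max_lt_iff, map_mul, norm_mul, hT] at h₃
    rw [← hj, norm_quadEmb hT hρ, max_lt_iff, map_mul, norm_mul, hT] at h₄
    refine ⟨?_, h₃.2, ?_, h₄.2⟩
    · exact (le_mul_of_one_le_left (norm_nonneg _) one_le_two).trans_lt h₃.1
    · exact (le_mul_of_one_le_left (norm_nonneg _) one_le_two).trans_lt h₄.1
  · intro γ _ δ _ h
    simp only [Prod.mk.injEq] at h
    exact gamma_ext h.1 h.2.1 h.2.2.1 h.2.2.2

end Coset

/-! ### The product of the main factors -/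

/-- Product in `𝔽₄[T]`, the pair `(m, n)` standing for `ofBits m * ρ + ofBits n`. -/
def bitMulQuad (z w : ℕ × ℕ) : ℕ × ℕ :=
  evalFirst (bitMul w.1 z.1) fun p =>
  evalFirst (Nat.xor p (Nat.xor (bitMul w.2 z.1) (bitMul w.1 z.2))) fun x =>
  evalFirst (Nat.xor p (bitMul w.2 z.2)) fun y => (x, y)

/-- The product of `lowVal` and `conjVal` at the matrix with binary expansions `l`. -/
def bitDenom (l : ℕ × ℕ × ℕ × ℕ) : ℕ × ℕ :=
  bitMulQuad (2 * l.2.2.1, l.2.2.2)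
    (2 * bitConjLeft l.1 l.2.1 l.2.2.1 l.2.2.2, bitConjRight l.1 l.2.1 l.2.2.1 l.2.2.2)

/-- The sum of `crossConst` and `bitDenom l`. -/
def bitNumer (l : ℕ × ℕ × ℕ × ℕ) : ℕ × ℕ :=
  (Nat.xor 12 (bitDenom l).1, Nat.xor 12 (bitDenom l).2)

/-- The product of `g` over `l` in `𝔽₄[T]`. -/
def bitProd {ι : Type} (g : ι → ℕ × ℕ) (l : List ι) : ℕ × ℕ :=
  (l.map g).foldr bitMulQuad (0, 1)

/-- The product of `bitDenom` over `cosetCodes`. -/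
def denomProd : ℕ × ℕ := bitProd bitDenom cosetCodes

/-- The product of `bitNumer` over `cosetCodes`. -/
def numerProd : ℕ × ℕ := bitProd bitNumer cosetCodes

/-- Whether `numerProd` agrees with `X ^ 4` times `denomProd` up to degree less than `k`, and
`denomProd` has degree at least `k`. -/
def quotientClose (k : ℕ) : Bool :=
  Nat.ble (Nat.xor numerProd.1 (16 * denomProd.1) + 1) (2 ^ k) &&
  Nat.ble (Nat.xor numerProd.2 (16 * denomProd.2) + 1) (2 ^ k) &&
  Nat.ble (2 ^ k) denomProd.1

theorem quotientClose_eq_true : quotientClose 474 = true := by decide +kernel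

theorem lt_of_quotientClose {k : ℕ} (h : quotientClose k = true) :
    Nat.xor numerProd.1 (16 * denomProd.1) < 2 ^ k ∧
      Nat.xor numerProd.2 (16 * denomProd.2) < 2 ^ k ∧ 2 ^ k ≤ denomProd.1 := by
  simp only [quotientClose, Bool.and_eq_true] at h
  exact ⟨Nat.lt_of_succ_le (Nat.le_of_ble_eq_true h.1.1),
    Nat.lt_of_succ_le (Nat.le_of_ble_eq_true h.1.2), Nat.le_of_ble_eq_true h.2⟩

section Quotient

variable {C : Type*} [NormedField C] [Algebra (LaurentSeries (ZMod 2)) C]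

/-- The element `ofBits z.1 * ρ + ofBits z.2`. -/
noncomputable def quadVal (ρ : C) (z : ℕ × ℕ) : C := quadEmb ρ (ofBits z.1) (ofBits z.2)

theorem quadVal_bitMulQuad {ρ : C} (hρ : ρ ^ 2 + ρ + 1 = 0) (z w : ℕ × ℕ) :
    quadVal ρ (bitMulQuad z w) = quadVal ρ z * quadVal ρ w := by
  have h2 : (2 : C) = 0 := two_eq_zero_of_algebra
  simp only [bitMulQuad, evalFirst_eq, quadVal, quadEmb, ofBits_xor, ofBits_bitMul, map_add,
    map_mul]
  linear_combination polyEmb2 C (ofBits z.1) * polyEmb2 C (ofBits w.1) * ((ρ + 1) * h2 - hρ)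

theorem quadVal_bitProd {ρ : C} (hρ : ρ ^ 2 + ρ + 1 = 0) {ι : Type} (g : ι → ℕ × ℕ)
    (l : List ι) : quadVal ρ (bitProd g l) = (l.map fun i => quadVal ρ (g i)).prod := by
  induction l with
  | nil => simp [bitProd, quadVal, quadEmb, ofBits_zero, ofBits_one]
  | cons i l ih =>
    rw [List.map_cons, List.prod_cons, ← ih, ← quadVal_bitMulQuad hρ]
    rfl

theorem quadVal_xor (ρ : C) (m n m' n' : ℕ) :
    quadVal ρ (Nat.xor m m', Nat.xor n n') = quadVal ρ (m, n) + quadVal ρ (m', n') := by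
  simp only [quadVal, quadEmb, ofBits_xor, map_add]
  ring

theorem quadVal_sixteen_mul (ρ : C) (z : ℕ × ℕ) :
    quadVal ρ (16 * z.1, 16 * z.2) = polyEmb2 C (X ^ 4) * quadVal ρ z := by
  have h (n : ℕ) : ofBits (16 * n) = X ^ 4 * ofBits n := by
    rw [show 16 * n = 2 * (8 * n) by ring, ofBits_two_mul, ofBits_eight_mul]
    ring
  simp only [quadVal, quadEmb, h, map_mul]
  ring

theorem quadVal_bitDenom {ρ : C} (hρ : ρ ^ 2 + ρ + 1 = 0) {l : ℕ × ℕ × ℕ × ℕ}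
    (hl : codeMatrix l ∈ Gamma0T3) :
    quadVal ρ (bitDenom l) = lowVal ρ ⟨codeMatrix l, hl⟩ * conjVal ρ ⟨codeMatrix l, hl⟩ := by
  rw [bitDenom, quadVal_bitMulQuad hρ, lowVal, conjVal, lowLeft_codeMatrix, gammaLeft_codeMatrix,
    gammaRight_codeMatrix, ← ofBits_two_mul, ← ofBits_two_mul]
  rfl

theorem quadVal_bitNumer (ρ : C) (l : ℕ × ℕ × ℕ × ℕ) :
    quadVal ρ (bitNumer l) = crossConst ρ + quadVal ρ (bitDenom l) := by
  rw [bitNumer, quadVal_xor, crossConst, ← ofBits_twelve]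
  rfl

variable [IsUltrametricDist C]

theorem cosetProd_mul_denomProd (hT : ‖polyEmb2 C X‖ = 2) {ρ : C} (hρ : ρ ^ 2 + ρ + 1 = 0) :
    (∏ γ ∈ cosetList.toFinset, (1 + crossConst ρ / (lowVal ρ γ * conjVal ρ γ))) *
      quadVal ρ denomProd = quadVal ρ numerProd := by
  have hmap : cosetList.map (fun γ => 1 + crossConst ρ / (lowVal ρ γ * conjVal ρ γ)) =
      cosetCodes.map fun l => 1 + crossConst ρ / quadVal ρ (bitDenom l) := by
    rw [cosetList, List.map_pmap, ← List.pmap_eq_map fun l hl => hl]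
    exact List.pmap_congr_left _ fun l hl _ _ => by
      rw [quadVal_bitDenom hρ (codeMatrix_mem hl)]
  rw [List.prod_toFinset _ nodup_cosetList, hmap, denomProd, numerProd,
    quadVal_bitProd hρ, quadVal_bitProd hρ]
  refine (list_prod_one_add_div cosetCodes (crossConst ρ) fun l hl => ?_).trans ?_
  · rw [quadVal_bitDenom hρ (codeMatrix_mem hl)]
    exact mul_ne_zero (lowVal_ne_zero hT hρ _) (conjVal_ne_zero hT hρ _)
  · exact congrArg List.prod (List.map_congr_left fun l _ => (quadVal_bitNumer ρ l).symm)

theorem norm_cosetProd_sub_lt_one (hT : ‖polyEmb2 C X‖ = 2) {ρ : C} (hρ : ρ ^ 2 + ρ + 1 = 0) :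
    ‖∏ γ ∈ cosetList.toFinset, (1 + crossConst ρ / (lowVal ρ γ * conjVal ρ γ)) -
      polyEmb2 C (X ^ 4)‖ < 1 := by
  obtain ⟨k, hk⟩ : ∃ k, quotientClose k = true := ⟨474, quotientClose_eq_true⟩
  obtain ⟨h₁, h₂, h₃⟩ := lt_of_quotientClose hk
  have hden : (2 : ℝ) ^ k ≤ ‖quadVal ρ denomProd‖ := by
    rw [quadVal, norm_quadEmb hT hρ]
    exact le_max_of_le_left (not_lt.1 fun h => h₃.not_gt ((norm_polyEmb2_ofBits_lt_iff hT).1 h))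
  have hnum : ‖quadVal ρ numerProd + polyEmb2 C (X ^ 4) * quadVal ρ denomProd‖ < 2 ^ k := by
    rw [← quadVal_sixteen_mul, ← quadVal_xor, quadVal, norm_quadEmb hT hρ]
    exact max_lt ((norm_polyEmb2_ofBits_lt_iff hT).2 h₁) ((norm_polyEmb2_ofBits_lt_iff hT).2 h₂)
  have h2 : (2 : C) = 0 := two_eq_zero_of_algebra
  refine lt_of_mul_lt_mul_right (a := ‖quadVal ρ denomProd‖) ?_ (norm_nonneg _)
  rw [← norm_mul, sub_mul, cosetProd_mul_denomProd hT hρ, one_mul, sub_eq_add_neg,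
    show -(polyEmb2 C (X ^ 4) * quadVal ρ denomProd) =
      polyEmb2 C (X ^ 4) * quadVal ρ denomProd by
        linear_combination -(polyEmb2 C (X ^ 4) * quadVal ρ denomProd) * h2]
  exact hnum.trans_le hden

end Quotient

theorem norm_inv_sub_inv_lt {C : Type*} [NormedField C] [IsUltrametricDist C] {x y : C}
    (hy : 1 ≤ ‖y‖) (hxy : ‖x - y‖ < 1) : ‖x⁻¹ - y⁻¹‖ < (‖y‖ ^ 2)⁻¹ := by
  have hx : ‖x‖ = ‖y‖ := by
    rw [← sub_add_cancel x y,
      IsUltrametricDist.norm_add_eq_max_of_norm_ne_norm (hxy.trans_le hy).ne,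
      max_eq_right (hxy.trans_le hy).le]
  have hy₀ : 0 < ‖y‖ := one_pos.trans_le hy
  rw [inv_sub_inv (norm_pos_iff.1 (hx ▸ hy₀)) (norm_pos_iff.1 hy₀), norm_div, norm_mul, hx,
    norm_sub_rev, ← sq, ← one_div]
  gcongr

/-- **Computation of the multiplier `c_α(α)` (Section 8.1).**  With `ω = T⁻²·ρ`
(`ρ² + ρ + 1 = 0`) and `r = α·∞ = (T²+T+1)/T³`, the family
`γ ↦ (r - γω)/(r - γ(αω))`, indexed by `γ ∈ Γ = Γ₀(T³)`, is multipliable; its product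
`c` satisfies `|c - T⁴| < 1`, and `t := c⁻¹` satisfies `|t - π⁴| < 2⁻⁸`. -/
theorem multiplier_c_alpha_alpha {C : Type*} [NormedField C] [CompleteSpace C]
    [Algebra (LaurentSeries (ZMod 2)) C]
    (hna : ∀ x y : C, ‖x + y‖ ≤ max ‖x‖ ‖y‖)
    (hext : ∀ x : LaurentSeries (ZMod 2), ‖algebraMap (LaurentSeries (ZMod 2)) C x‖ = absK2 x)
    (ρ : C) (hρ : ρ ^ 2 + ρ + 1 = 0)
    (ω : C) (hω : ω = (polyEmb2 C Polynomial.X) ⁻¹ ^ 2 * ρ)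
    (rr : C) (hrr : rr = polyEmb2 C (Polynomial.X ^ 2 + Polynomial.X + 1) /
      polyEmb2 C (Polynomial.X ^ 3)) :
    Multipliable (fun γ : Gamma0T3 =>
      (rr - act2 γ.val ω) / (rr - act2 γ.val (act2 alpha2 ω))) ∧
    ‖(∏' γ : Gamma0T3, (rr - act2 γ.val ω) / (rr - act2 γ.val (act2 alpha2 ω)))
        - polyEmb2 C (Polynomial.X ^ 4)‖ < 1 ∧
    ‖(∏' γ : Gamma0T3, (rr - act2 γ.val ω) / (rr - act2 γ.val (act2 alpha2 ω)))⁻¹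
        - ((polyEmb2 C Polynomial.X)⁻¹) ^ 4‖ < (2 : ℝ) ^ (-8 : ℤ) := by
  have := IsUltrametricDist.isUltrametricDist_of_forall_norm_add_le_max_norm hna
  have hT : ‖polyEmb2 C X‖ = 2 := by rw [polyEmb2_X, hext, absK2_Tel2]
  simp only [factor_eq hT hρ hω hrr]
  have hm := multipliable_one_add_of_finite_lt_norm fun ε hε => finite_lt_norm_factor hT hρ hε
  have hT4 : ‖polyEmb2 C (X ^ 4)‖ = 16 := by
    rw [map_pow, norm_pow, hT]
    norm_num
  have hclose := norm_cosetProd_sub_lt_one hT hρ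
  have htail := norm_tprod_one_add_sub_prod_le (s := cosetList.toFinset) (by norm_num)
    (by norm_num) (fun γ hγ => norm_factor_le_of_notMem hT hρ (mt List.mem_toFinset.2 hγ)) hm
  set P := ∏ γ ∈ cosetList.toFinset, (1 + crossConst ρ / (lowVal ρ γ * conjVal ρ γ))
  set c := ∏' γ : Gamma0T3, (1 + crossConst ρ / (lowVal ρ γ * conjVal ρ γ))
  have hP : ‖P‖ < 17 := by
    have := norm_add_le (P - polyEmb2 C (X ^ 4)) (polyEmb2 C (X ^ 4))
    rw [sub_add_cancel] at this
    linarith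
  have hc : ‖c - polyEmb2 C (X ^ 4)‖ < 1 := by
    rw [← sub_add_sub_cancel c P]
    exact (hna _ _).trans_lt (max_lt (by linarith) hclose)
  refine ⟨hm, hc, ?_⟩
  have hinv := norm_inv_sub_inv_lt (by rw [hT4]; norm_num) hc
  rw [hT4, map_pow, ← inv_pow] at hinv
  exact hinv.trans_eq (by norm_num)
end

section
/- The family gamma -> (1/T - gamma omega)/(1/T - gamma(alpha omega)), indexed by gamma in Gamma, is multipliable, and its product u_alpha(1/T) satisfies |u_alpha(1/T) - T| < 2^{-3} (note pi^{-1} = T). (Part of Proposition 8.1 of the paper.) -/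
open Polynomial Matrix
open scoped Classical

section EvalBits

variable {R : Type*} [CommRing R]

/-- The value at `x` of the polynomial over `F₂` whose coefficients are the binary digits of `n`. -/
def evalBits (x : R) (n : ℕ) : R := Nat.ofDigits x (Nat.digits 2 n)

@[simp] theorem evalBits_zero (x : R) : evalBits x 0 = 0 := by
  simp [evalBits, Nat.ofDigits]

theorem evalBits_eq (x : R) (n : ℕ) :
    evalBits x n = ((n % 2 : ℕ) : R) + x * evalBits x (n / 2) := by
  rcases Nat.eq_zero_or_pos n with rfl | hn
  · simp
  · rw [evalBits, Nat.digits_def' one_lt_two hn]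
    rfl

@[simp] theorem evalBits_two_mul (x : R) (n : ℕ) : evalBits x (2 * n) = x * evalBits x n := by
  rw [evalBits_eq]
  simp

@[simp] theorem evalBits_two_mul_add_one (x : R) (n : ℕ) :
    evalBits x (2 * n + 1) = 1 + x * evalBits x n := by
  rw [evalBits_eq, Nat.mul_add_mod, Nat.mul_add_div two_pos]
  simp

@[simp] theorem evalBits_one (x : R) : evalBits x 1 = 1 := by
  simpa using evalBits_two_mul_add_one x 0

theorem map_evalBits {S : Type*} [CommRing S] (φ : R →+* S) (x : R) (n : ℕ) :
    φ (evalBits x n) = evalBits (φ x) n := by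
  induction n using Nat.strong_induction_on with
  | _ n ih =>
    rcases Nat.eq_zero_or_pos n with rfl | hn
    · simp
    · rw [evalBits_eq, evalBits_eq (φ x), ← ih _ (Nat.div_lt_self hn one_lt_two)]
      simp

theorem natCast_mod_two (h2 : (2 : R) = 0) (n : ℕ) : ((n % 2 : ℕ) : R) = n := by
  conv_rhs => rw [← Nat.mod_add_div n 2]
  push_cast
  rw [h2, zero_mul, add_zero]

theorem evalBits_xor (h2 : (2 : R) = 0) (x : R) (m n : ℕ) :
    evalBits x (m ^^^ n) = evalBits x m + evalBits x n := by
  induction m using Nat.strong_induction_on generalizing n with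
  | _ m ih =>
    rcases Nat.eq_zero_or_pos m with rfl | hm
    · simp
    · rw [evalBits_eq x (m ^^^ n), evalBits_eq x m, evalBits_eq x n, Nat.xor_div_two,
        ih _ (Nat.div_lt_self hm one_lt_two), Nat.xor_mod_two_eq]
      simp only [natCast_mod_two h2]
      push_cast
      ring

end EvalBits

/-- Carry-less multiplication of binary expansions, with an explicit bound on the recursion. -/
def clmulAux : ℕ → ℕ → ℕ → ℕ
  | 0, _, _ => 0
  | n + 1, a, b => if b = 0 then 0 else (b % 2 * a) ^^^ clmulAux n (2 * a) (b / 2)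

/-- Carry-less multiplication of binary expansions: multiplication in `F₂[X]`. -/
def clmul (a b : ℕ) : ℕ := clmulAux b a b

theorem evalBits_clmul {R : Type*} [CommRing R] (h2 : (2 : R) = 0) (x : R) (a b : ℕ) :
    evalBits x (clmul a b) = evalBits x a * evalBits x b := by
  have aux : ∀ n a b : ℕ, b ≤ n →
      evalBits x (clmulAux n a b) = evalBits x a * evalBits x b := by
    intro n
    induction n with
    | zero => intro a b hb; simp [clmulAux, Nat.le_zero.mp hb]
    | succ n ih =>
      intro a b hb
      by_cases h0 : b = 0
      · simp [clmulAux, h0]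
      · rw [clmulAux, if_neg h0, evalBits_xor h2, ih _ _ (by omega), evalBits_eq x b,
          evalBits_two_mul]
        rcases Nat.mod_two_eq_zero_or_one b with h | h <;> rw [h] <;> simp <;> ring
  exact aux b a b le_rfl

open Polynomial in
theorem evalBits_X_injective : Function.Injective (evalBits (X : (ZMod 2)[X])) := by
  have aux : ∀ k m n : ℕ, m ≤ k → n ≤ k →
      evalBits (X : (ZMod 2)[X]) m = evalBits X n → m = n := by
    intro k
    induction k with
    | zero => intro m n hm hn _; omega
    | succ k ih =>
      intro m n hm hn h
      rw [evalBits_eq, evalBits_eq _ n] at h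
      have h0 := congrArg (fun p : (ZMod 2)[X] => p.coeff 0) h
      simp only [coeff_add, coeff_natCast_ite, mul_coeff_zero, coeff_X_zero, zero_mul, add_zero,
        if_true] at h0
      rw [ZMod.natCast_eq_natCast_iff', Nat.mod_mod, Nat.mod_mod] at h0
      rw [h0, add_right_inj] at h
      have := ih _ _ (by omega) (by omega) (mul_left_cancel₀ X_ne_zero h)
      omega
  intro m n h
  exact aux (max m n) m n (le_max_left _ _) (le_max_right _ _) h

open Polynomial in
theorem evalBits_X_surjective : Function.Surjective (evalBits (X : (ZMod 2)[X])) := by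
  intro p
  induction p using Polynomial.induction_on' with
  | add p q hp hq =>
    obtain ⟨m, rfl⟩ := hp
    obtain ⟨n, rfl⟩ := hq
    exact ⟨m ^^^ n, evalBits_xor CharTwo.two_eq_zero _ _ _⟩
  | monomial n a =>
    fin_cases a
    · exact ⟨0, (evalBits_zero _).trans (monomial_zero_right n).symm⟩
    · refine ⟨2 ^ n, ?_⟩
      have : ∀ k : ℕ, evalBits (X : (ZMod 2)[X]) (2 ^ k) = X ^ k := by
        intro k
        induction k with
        | zero => simp
        | succ k ih => rw [pow_succ', evalBits_two_mul, ih, pow_succ']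
      rw [this]
      exact X_pow_eq_monomial n

/-- A nonarchimedean field of characteristic two with an element `T` of absolute value `2` and a
primitive cube root of unity `ρ`. -/
structure CubeRootSetting {C : Type*} [NormedField C] (T ρ : C) : Prop where
  norm_add_le (x y : C) : ‖x + y‖ ≤ max ‖x‖ ‖y‖
  two_eq_zero : (2 : C) = 0
  norm_T : ‖T‖ = 2
  rho_eq : ρ ^ 2 + ρ + 1 = 0

/-- The value at `T` of the polynomial over `F₂(ρ)` with coordinates `p` in the basis `1, ρ`. -/
def evalPair {C : Type*} [CommRing C] (T ρ : C) (p : ℕ × ℕ) : C :=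
  evalBits T p.1 + evalBits T p.2 * ρ

/-- Addition of pairs representing polynomials over `F₄`. -/
def addPair (p q : ℕ × ℕ) : ℕ × ℕ := (p.1 ^^^ q.1, p.2 ^^^ q.2)

/-- Multiplication of pairs representing polynomials over `F₄`. -/
def mulPair (p q : ℕ × ℕ) : ℕ × ℕ :=
  (clmul p.1 q.1 ^^^ clmul p.2 q.2, clmul p.1 q.2 ^^^ clmul p.2 q.1 ^^^ clmul p.2 q.2)

namespace CubeRootSetting

variable {C : Type*} [NormedField C] {T ρ : C}

theorem T_ne_zero (S : CubeRootSetting T ρ) : T ≠ 0 := by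
  rw [← norm_ne_zero_iff, S.norm_T]
  exact two_ne_zero

theorem norm_rho (S : CubeRootSetting T ρ) : ‖ρ‖ = 1 := by
  have h : ρ ^ 3 = 1 := by linear_combination (ρ - 1) * S.rho_eq
  have h' : ‖ρ‖ ^ 3 = 1 := by rw [← norm_pow, h, norm_one]
  exact (pow_eq_one_iff_of_nonneg (norm_nonneg _) three_ne_zero).mp h'

theorem norm_one_add_rho (S : CubeRootSetting T ρ) : ‖1 + ρ‖ = 1 := by
  have h : 1 + ρ = -ρ ^ 2 := by linear_combination S.rho_eq
  rw [h, norm_neg, norm_pow, S.norm_rho, one_pow]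

theorem norm_add_eq_left (S : CubeRootSetting T ρ) {x y : C} (h : ‖y‖ < ‖x‖) :
    ‖x + y‖ = ‖x‖ := by
  refine le_antisymm ((S.norm_add_le x y).trans_eq (max_eq_left h.le)) ?_
  by_contra! hlt
  have := S.norm_add_le (x + y) (-y)
  rw [add_neg_cancel_right, norm_neg] at this
  exact absurd this (not_le.mpr (max_lt hlt h))

theorem evalPair_addPair (S : CubeRootSetting T ρ) (p q : ℕ × ℕ) :
    evalPair T ρ (addPair p q) = evalPair T ρ p + evalPair T ρ q := by
  simp only [evalPair, addPair, evalBits_xor S.two_eq_zero]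
  ring

theorem evalPair_mulPair (S : CubeRootSetting T ρ) (p q : ℕ × ℕ) :
    evalPair T ρ (mulPair p q) = evalPair T ρ p * evalPair T ρ q := by
  simp only [evalPair, mulPair, evalBits_xor S.two_eq_zero, evalBits_clmul S.two_eq_zero]
  linear_combination (-(evalBits T p.2 * evalBits T q.2)) * S.rho_eq +
    evalBits T p.2 * evalBits T q.2 * (1 + ρ) * S.two_eq_zero

theorem evalPair_eq (T ρ : C) (p : ℕ × ℕ) :
    evalPair T ρ p = T * evalPair T ρ (p.1 / 2, p.2 / 2) +
      (((p.1 % 2 : ℕ) : C) + ((p.2 % 2 : ℕ) : C) * ρ) := by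
  rw [evalPair, evalBits_eq T p.1, evalBits_eq T p.2, evalPair]
  ring

theorem norm_digit_le (S : CubeRootSetting T ρ) (m n : ℕ) :
    ‖((m % 2 : ℕ) : C) + ((n % 2 : ℕ) : C) * ρ‖ ≤ 1 := by
  rcases Nat.mod_two_eq_zero_or_one m with h | h <;>
    rcases Nat.mod_two_eq_zero_or_one n with h' | h' <;>
    simp [h, h', S.norm_rho, S.norm_one_add_rho]

theorem norm_evalPair_le (S : CubeRootSetting T ρ) (k : ℕ) (p : ℕ × ℕ)
    (h₁ : p.1 < 2 ^ (k + 1)) (h₂ : p.2 < 2 ^ (k + 1)) : ‖evalPair T ρ p‖ ≤ 2 ^ k := by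
  induction k generalizing p with
  | zero =>
    rw [evalPair_eq, Nat.div_eq_of_lt (by simpa using h₁), Nat.div_eq_of_lt (by simpa using h₂)]
    simpa [evalPair] using S.norm_digit_le p.1 p.2
  | succ k ih =>
    rw [evalPair_eq]
    refine (S.norm_add_le _ _).trans (max_le ?_ ?_)
    · rw [norm_mul, S.norm_T, pow_succ']
      have := ih (p.1 / 2, p.2 / 2) (by simp only; omega) (by simp only; omega)
      gcongr
    · exact (S.norm_digit_le _ _).trans (one_le_pow₀ one_le_two)

theorem le_norm_evalPair (S : CubeRootSetting T ρ) (k : ℕ) (p : ℕ × ℕ)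
    (h : 2 ^ k ≤ max p.1 p.2) : (2 : ℝ) ^ k ≤ ‖evalPair T ρ p‖ := by
  obtain ⟨n, hn⟩ : ∃ n, max p.1 p.2 ≤ n := ⟨_, le_rfl⟩
  induction n generalizing p k with
  | zero =>
    have := Nat.one_le_two_pow (n := k)
    omega
  | succ n ih =>
    rw [evalPair_eq]
    by_cases hp : max p.1 p.2 < 2
    · have hk : k = 0 := by
        by_contra hk
        have : 2 ^ 1 ≤ 2 ^ k := Nat.pow_le_pow_right two_pos (Nat.one_le_iff_ne_zero.mpr hk)
        omega
      subst hk
      obtain ⟨a, b⟩ := p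
      simp only at h hp ⊢
      have ha : a < 2 := by omega
      have hb : b < 2 := by omega
      interval_cases a <;> interval_cases b <;>
        simp_all [evalPair, S.norm_rho, S.norm_one_add_rho]
    · have key : ∀ j : ℕ, 2 ^ j ≤ max (p.1 / 2) (p.2 / 2) →
          (2 : ℝ) ^ (j + 1) ≤ ‖T * evalPair T ρ (p.1 / 2, p.2 / 2)‖ := by
        intro j hj
        rw [norm_mul, S.norm_T, pow_succ']
        have := ih j (p.1 / 2, p.2 / 2) hj (by simp only; omega)
        gcongr
      have h1 := key 0 (by omega)
      rw [S.norm_add_eq_left (lt_of_le_of_lt (S.norm_digit_le _ _)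
        (lt_of_lt_of_le (by norm_num) h1))]
      rcases k with _ | k
      · exact le_trans (by norm_num) h1
      · exact key k (by rw [pow_succ] at h; omega)

theorem evalPair_ne_zero (S : CubeRootSetting T ρ) {p : ℕ × ℕ} (h : 1 ≤ max p.1 p.2) :
    evalPair T ρ p ≠ 0 := by
  have := S.le_norm_evalPair 0 p (by simpa using h)
  rw [← norm_pos_iff]
  exact lt_of_lt_of_le (by norm_num) this

theorem one_le_norm_evalPair (S : CubeRootSetting T ρ) {p : ℕ × ℕ} (h : 1 ≤ max p.1 p.2) :
    1 ≤ ‖evalPair T ρ p‖ := by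
  simpa using S.le_norm_evalPair 0 p (by simpa using h)

theorem norm_prod_sub_one_le (S : CubeRootSetting T ρ) {ι : Type*} {g : ι → C} {ε : ℝ}
    (h0 : 0 ≤ ε) (h1 : ε < 1) (s : Finset ι) (hs : ∀ i ∈ s, ‖g i - 1‖ ≤ ε) :
    ‖∏ i ∈ s, g i - 1‖ ≤ ε ∧ ‖∏ i ∈ s, g i‖ = 1 := by
  have unit : ∀ x : C, ‖x - 1‖ ≤ ε → ‖x‖ = 1 := by
    intro x hx
    have := S.norm_add_eq_left (x := 1) (y := x - 1) (by rw [norm_one]; linarith)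
    rwa [add_sub_cancel, norm_one] at this
  suffices h : ‖∏ i ∈ s, g i - 1‖ ≤ ε from ⟨h, unit _ h⟩
  induction s using Finset.cons_induction with
  | empty => simpa using h0
  | cons a s ha ih =>
    have ih' := ih fun i hi => hs i (Finset.mem_cons_of_mem hi)
    have hga := hs a (Finset.mem_cons_self a s)
    rw [Finset.prod_cons,
      show g a * ∏ i ∈ s, g i - 1 = g a * (∏ i ∈ s, g i - 1) + (g a - 1) by ring]
    refine (S.norm_add_le _ _).trans (max_le ?_ hga)
    rw [norm_mul, unit _ hga, one_mul]
    exact ih'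

theorem norm_prod_sub_prod_le (S : CubeRootSetting T ρ) {ι : Type*} {g : ι → C} {ε : ℝ}
    (h0 : 0 ≤ ε) (h1 : ε < 1) {F s : Finset ι} (hF : ∀ i ∉ F, ‖g i - 1‖ ≤ ε) (hs : F ⊆ s) :
    ‖∏ i ∈ s, g i - ∏ i ∈ F, g i‖ ≤ ‖∏ i ∈ F, g i‖ * ε := by
  rw [← Finset.prod_sdiff hs,
    show ∀ x y : C, x * y - y = y * (x - 1) by intros; ring, norm_mul]
  gcongr
  exact (S.norm_prod_sub_one_le h0 h1 _ fun i hi => hF i (Finset.mem_sdiff.mp hi).2).1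

theorem multipliable_of_finite [CompleteSpace C] (S : CubeRootSetting T ρ) {ι : Type*} {g : ι → C}
    (hg : ∀ ε > 0, {i | ε < ‖g i - 1‖}.Finite) : Multipliable g := by
  have hout : ∀ ε > 0, ∃ F : Finset ι, ∀ i ∉ F, ‖g i - 1‖ ≤ ε := fun ε hε =>
    ⟨(hg ε hε).toFinset, fun i hi => by simpa using hi⟩
  obtain ⟨F₀, hF₀⟩ := hout (1 / 2) (by norm_num)
  set M := ‖∏ i ∈ F₀, g i‖ with hM
  have hprod : ∀ s, F₀ ⊆ s → ‖∏ i ∈ s, g i‖ = M := by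
    intro s hs
    rw [← Finset.prod_sdiff hs, norm_mul, (S.norm_prod_sub_one_le (by norm_num) (by norm_num) _
      fun i hi => hF₀ i (Finset.mem_sdiff.mp hi).2).2, one_mul]
  have hc : CauchySeq fun s : Finset ι => ∏ i ∈ s, g i := by
    refine Metric.cauchySeq_iff'.mpr fun ε hε => ?_
    have hM0 : 0 ≤ M := norm_nonneg _
    have hδ : 0 < min (1 / 2) (ε / (2 * (M + 1))) := by positivity
    obtain ⟨F, hF⟩ := hout _ hδ
    refine ⟨F₀ ∪ F, fun s hs => ?_⟩
    rw [dist_eq_norm]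
    refine (S.norm_prod_sub_prod_le hδ.le (lt_of_le_of_lt (min_le_left _ _) (by norm_num))
      (fun i hi => hF i fun h => hi (Finset.mem_union_right _ h)) hs).trans_lt ?_
    rw [hprod _ Finset.subset_union_left]
    calc M * min (1 / 2) (ε / (2 * (M + 1))) ≤ (M + 1) * (ε / (2 * (M + 1))) :=
          mul_le_mul (by linarith) (min_le_right _ _) hδ.le (by linarith)
      _ = ε / 2 := by field_simp
      _ < ε := by linarith
  obtain ⟨a, ha⟩ := cauchySeq_tendsto_of_complete hc
  exact ⟨a, ha⟩

theorem norm_tprod_sub_prod_le (S : CubeRootSetting T ρ) {ι : Type*} {g : ι → C} {ε : ℝ}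
    (h0 : 0 ≤ ε) (h1 : ε < 1) (hg : Multipliable g) {F : Finset ι}
    (hF : ∀ i ∉ F, ‖g i - 1‖ ≤ ε) :
    ‖∏' i, g i - ∏ i ∈ F, g i‖ ≤ ‖∏ i ∈ F, g i‖ * ε := by
  have ht : Filter.Tendsto (fun s : Finset ι => ‖∏ i ∈ s, g i - ∏ i ∈ F, g i‖) Filter.atTop
      (nhds ‖∏' i, g i - ∏ i ∈ F, g i‖) := (hg.hasProd.sub_const _).norm
  refine le_of_tendsto ht ?_
  filter_upwards [Filter.eventually_ge_atTop F] with s hs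
  exact S.norm_prod_sub_prod_le h0 h1 hF hs

end CubeRootSetting

/-- The left-hand side of the determinant relation satisfied by the index `((c, d), (e, f))`. -/
def relLeft (t : (ℕ × ℕ) × ℕ × ℕ) : ℕ :=
  clmul (2 * (2 * (2 * t.1.1)) ^^^ clmul (2 * t.1.2 + 1) 3) (2 * t.2.1 + 1) ^^^
    2 * (2 * clmul (clmul t.1.1 7 ^^^ (2 * t.1.2 + 1)) (2 * t.2.2 + 1))

/-- The product of the two denominators attached to the index `((c, d), (e, f))`. -/
def denPair (t : (ℕ × ℕ) × ℕ × ℕ) : ℕ × ℕ :=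
  mulPair (2 * t.1.2 + 1, 2 * t.1.1) (2 * (2 * t.2.2 + 1), 2 * t.2.1 + 1)

theorem evalBits_three {R : Type*} [CommRing R] (x : R) : evalBits x 3 = 1 + x := by
  simpa using evalBits_two_mul_add_one x 1

theorem evalBits_seven {R : Type*} [CommRing R] (x : R) : evalBits x 7 = x ^ 2 + x + 1 := by
  have := evalBits_two_mul_add_one x 3
  rw [evalBits_three] at this
  rw [show 7 = 2 * 3 + 1 from rfl, this]
  ring

theorem evalBits_relLeft {R : Type*} [CommRing R] (h2 : (2 : R) = 0) (x : R)
    (t : (ℕ × ℕ) × ℕ × ℕ) :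
    evalBits x (relLeft t) =
      (x ^ 3 * evalBits x t.1.1 + (1 + x * evalBits x t.1.2) * (1 + x)) *
          (1 + x * evalBits x t.2.1) +
        x ^ 2 * ((x ^ 2 + x + 1) * evalBits x t.1.1 + (1 + x * evalBits x t.1.2)) *
          (1 + x * evalBits x t.2.2) := by
  simp only [relLeft, evalBits_xor h2, evalBits_clmul h2, evalBits_two_mul,
    evalBits_two_mul_add_one, evalBits_three, evalBits_seven]
  ring

/-- The matrix in `Γ₀(T³)` with index `((c, d), (e, f))`, over a ring with an element `x`. -/
def indexMatrix {R : Type*} [CommRing R] (x : R) (t : (ℕ × ℕ) × ℕ × ℕ) : Matrix (Fin 2) (Fin 2) R :=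
  let c := evalBits x t.1.1
  let d := evalBits x t.1.2
  let e := evalBits x t.2.1
  let f := evalBits x t.2.2
  !![(1 + x * e) * (1 + x) + (1 + x * f) * x ^ 2 + x ^ 2 * c,
      (1 + x * e) + (1 + x * f) * (x + 1) + f + d;
    x ^ 3 * c, 1 + x * d]

section IndexIdentities

variable {R : Type*} [CommRing R]

theorem det_indexMatrix (h2 : (2 : R) = 0) (x : R) {t : (ℕ × ℕ) × ℕ × ℕ} (ht : relLeft t = 1) :
    (indexMatrix x t).det = 1 := by
  have h := evalBits_relLeft h2 x t
  rw [ht, evalBits_one] at h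
  rw [Matrix.det_fin_two]
  simp only [indexMatrix, Matrix.of_apply, Matrix.cons_val', Matrix.cons_val_zero,
    Matrix.cons_val_one, Matrix.cons_val_fin_one]
  generalize evalBits x t.1.1 = c at *
  generalize evalBits x t.1.2 = d at *
  generalize evalBits x t.2.1 = e at *
  generalize evalBits x t.2.2 = f at *
  grind

theorem index_relation (h2 : (2 : R) = 0) {x a b c d e f : R}
    (hd : a * (1 + x * d) - b * (x ^ 3 * c) = 1)
    (he : 1 + x * e = (x ^ 2 * c + a) * (x ^ 2 + x + 1) + ((1 + x * d) + x * b) * x ^ 2)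
    (hf : 1 + x * f = x ^ 3 * c + x * a + ((1 + x * d) + x * b) * (1 + x)) :
    (x ^ 3 * c + (1 + x * d) * (1 + x)) * (1 + x * e) +
      x ^ 2 * ((x ^ 2 + x + 1) * c + (1 + x * d)) * (1 + x * f) = 1 := by
  rw [he, hf]
  clear he hf
  grind

theorem index_entries_iff (h2 : (2 : R) = 0) [IsDomain R] {x : R} (hx : x ≠ 0) {a b c d e f : R} :
    (a = (1 + x * e) * (1 + x) + (1 + x * f) * x ^ 2 + x ^ 2 * c ∧
      b = (1 + x * e) + (1 + x * f) * (x + 1) + f + d) ↔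
    (1 + x * e = (x ^ 2 * c + a) * (x ^ 2 + x + 1) + ((1 + x * d) + x * b) * x ^ 2 ∧
      1 + x * f = x ^ 3 * c + x * a + ((1 + x * d) + x * b) * (1 + x)) := by
  constructor
  · rintro ⟨rfl, rfl⟩
    constructor <;> grind
  · rintro ⟨he, hf⟩
    constructor
    · rw [he, hf]
      grind
    · refine mul_left_cancel₀ hx ?_
      rw [show x * (1 + x * e + (1 + x * f) * (x + 1) + f + d) =
        x * (1 + x * e) + x * (1 + x * f) * (x + 1) + (1 + x * f) + (1 + x * d) - 2 by ring, he, hf]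
      grind

end IndexIdentities

open Polynomial in
theorem indexMatrix_mem_Gamma0T3 {t : (ℕ × ℕ) × ℕ × ℕ} (ht : relLeft t = 1) :
    indexMatrix (X : (ZMod 2)[X]) t ∈ Gamma0T3 :=
  ⟨det_indexMatrix CharTwo.two_eq_zero X ht, by simp [indexMatrix]⟩

/-- The matrix in `Γ₀(T³)` attached to an index satisfying the determinant relation. -/
noncomputable def indexToGamma (t : {t : (ℕ × ℕ) × ℕ × ℕ // relLeft t = 1}) : Gamma0T3 :=
  ⟨indexMatrix Polynomial.X t.1, indexMatrix_mem_Gamma0T3 t.2⟩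

open Polynomial in
theorem indexToGamma_injective : Function.Injective indexToGamma := by
  rintro ⟨⟨⟨c, d⟩, e, f⟩, ht⟩ ⟨⟨⟨c', d'⟩, e', f'⟩, ht'⟩ h
  have h := congrArg Subtype.val h
  have hX : (X : (ZMod 2)[X]) ≠ 0 := X_ne_zero
  have h2 : (2 : (ZMod 2)[X]) = 0 := CharTwo.two_eq_zero
  have h00 := congrFun (congrFun h 0) 0
  have h01 := congrFun (congrFun h 0) 1
  have h10 := congrFun (congrFun h 1) 0
  have h11 := congrFun (congrFun h 1) 1
  simp only [indexToGamma, indexMatrix, Matrix.of_apply, Matrix.cons_val', Matrix.cons_val_zero,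
    Matrix.cons_val_one, Matrix.cons_val_fin_one] at h00 h01 h10 h11
  have hc := evalBits_X_injective (mul_left_cancel₀ (pow_ne_zero 3 hX) h10)
  have hd := evalBits_X_injective (mul_left_cancel₀ hX (add_left_cancel h11))
  subst hc hd
  obtain ⟨he, hf⟩ := (index_entries_iff h2 hX).mp ⟨rfl, rfl⟩
  obtain ⟨he', hf'⟩ := (index_entries_iff h2 hX).mp ⟨h00, h01⟩
  have hee := evalBits_X_injective
    (mul_left_cancel₀ hX (add_left_cancel (he.trans he'.symm)))
  have hff := evalBits_X_injective
    (mul_left_cancel₀ hX (add_left_cancel (hf.trans hf'.symm)))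
  subst hee hff
  rfl

open Polynomial in
theorem exists_eq_one_add_X_mul {p : (ZMod 2)[X]} (hp : p.coeff 0 = 1) : ∃ q, p = 1 + X * q := by
  refine ⟨p.divX, ?_⟩
  conv_lhs => rw [← X_mul_divX_add p, hp]
  rw [map_one, add_comm]

open Polynomial in
theorem indexToGamma_surjective : Function.Surjective indexToGamma := by
  rintro ⟨g, hdet, c, hc⟩
  rw [Matrix.det_fin_two, hc] at hdet
  have hX : (X : (ZMod 2)[X]) ≠ 0 := X_ne_zero
  have h2 : (2 : (ZMod 2)[X]) = 0 := CharTwo.two_eq_zero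
  have hcoeff : (g 0 0).coeff 0 * (g 1 1).coeff 0 = 1 := by
    have := congrArg (fun p : (ZMod 2)[X] => p.coeff 0) hdet
    simpa [mul_coeff_zero] using this
  have hunit : ∀ x y : ZMod 2, x * y = 1 → x = 1 ∧ y = 1 := by decide
  obtain ⟨ha, hd⟩ := hunit _ _ hcoeff
  obtain ⟨d, hd⟩ := exists_eq_one_add_X_mul hd
  obtain ⟨e, he⟩ : ∃ e, (X ^ 2 * c + g 0 0) * (X ^ 2 + X + 1) + ((1 + X * d) + X * g 0 1) * X ^ 2 =
      1 + X * e := exists_eq_one_add_X_mul (by simp [mul_coeff_zero, ha])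
  obtain ⟨f, hf⟩ : ∃ f, X ^ 3 * c + X * g 0 0 + ((1 + X * d) + X * g 0 1) * (1 + X) =
      1 + X * f := exists_eq_one_add_X_mul (by simp [mul_coeff_zero])
  rw [hd] at hdet
  have hrel := index_relation h2 hdet he.symm hf.symm
  have hent := (index_entries_iff h2 hX).mpr ⟨he.symm, hf.symm⟩
  obtain ⟨c, rfl⟩ := evalBits_X_surjective c
  obtain ⟨d, rfl⟩ := evalBits_X_surjective d
  obtain ⟨e, rfl⟩ := evalBits_X_surjective e
  obtain ⟨f, rfl⟩ := evalBits_X_surjective f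
  refine ⟨⟨((c, d), e, f), evalBits_X_injective ?_⟩, Subtype.ext ?_⟩
  · rw [evalBits_relLeft h2, evalBits_one]
    exact hrel
  · ext1 i j
    fin_cases i <;> fin_cases j
    · exact hent.1.symm
    · exact hent.2.symm
    · exact hc.symm
    · exact hd.symm

theorem indexToGamma_bijective : Function.Bijective indexToGamma :=
  ⟨indexToGamma_injective, indexToGamma_surjective⟩

theorem numerator_eq {R : Type*} [CommRing R] (h2 : (2 : R) = 0) {T ρ c d e f : R}
    (hρ : ρ ^ 2 + ρ + 1 = 0)
    (h : (T ^ 3 * c + d * (1 + T)) * e + T ^ 2 * ((T ^ 2 + T + 1) * c + d) * f = 1) :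
    ((e * (1 + T) + T ^ 2 * f) * ρ + T * (T * e + (T ^ 2 + T + 1) * f)) *
        ((T ^ 3 * c + (1 + T) * d) + T * ((T ^ 2 + T + 1) * c + d) * ρ) =
      (d + T * c * ρ) * (T * f + e * ρ) + (T ^ 2 + T) * (1 + ρ) := by
  grind

namespace CubeRootSetting

variable {C : Type*} [NormedField C] {T ρ : C}

theorem evalPair_denPair (S : CubeRootSetting T ρ) (t : (ℕ × ℕ) × ℕ × ℕ) :
    evalPair T ρ (denPair t) =
      ((1 + T * evalBits T t.1.2) + T * evalBits T t.1.1 * ρ) *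
        (T * (1 + T * evalBits T t.2.2) + (1 + T * evalBits T t.2.1) * ρ) := by
  rw [denPair, S.evalPair_mulPair]
  simp only [evalPair, evalBits_two_mul, evalBits_two_mul_add_one]

theorem evalBits_six (T : C) : evalBits T 6 = T ^ 2 + T := by
  rw [show 6 = 2 * 3 from rfl, evalBits_two_mul, evalBits_three]
  ring

theorem dual_row_ne_zero (S : CubeRootSetting T ρ) {t : (ℕ × ℕ) × ℕ × ℕ} (ht : relLeft t = 1) :
    (T ^ 3 * evalBits T t.1.1 + (1 + T) * (1 + T * evalBits T t.1.2)) +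
      T * ((T ^ 2 + T + 1) * evalBits T t.1.1 + (1 + T * evalBits T t.1.2)) * ρ ≠ 0 := by
  have h := evalBits_relLeft S.two_eq_zero T t
  rw [ht, evalBits_one] at h
  set p : ℕ × ℕ := (2 * (2 * (2 * t.1.1)) ^^^ clmul (2 * t.1.2 + 1) 3,
    2 * (clmul t.1.1 7 ^^^ (2 * t.1.2 + 1))) with hp
  have hp1 : evalBits T p.1 =
      T ^ 3 * evalBits T t.1.1 + (1 + T) * (1 + T * evalBits T t.1.2) := by
    simp only [hp, evalBits_xor S.two_eq_zero, evalBits_clmul S.two_eq_zero, evalBits_two_mul,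
      evalBits_two_mul_add_one, evalBits_three]
    ring
  have hp2 : evalBits T p.2 =
      T * ((T ^ 2 + T + 1) * evalBits T t.1.1 + (1 + T * evalBits T t.1.2)) := by
    simp only [hp, evalBits_xor S.two_eq_zero, evalBits_clmul S.two_eq_zero, evalBits_two_mul,
      evalBits_two_mul_add_one, evalBits_seven]
    ring
  rw [← hp1, ← hp2]
  refine S.evalPair_ne_zero (p := p) ?_
  by_contra hlt
  have h1 : p.1 = 0 := by omega
  have h2 : p.2 = 0 := by omega
  rw [h1, evalBits_zero] at hp1
  rw [h2, evalBits_zero] at hp2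
  refine one_ne_zero (α := C) (h.trans ?_)
  linear_combination -(1 + T * evalBits T t.2.1) * hp1 - T * (1 + T * evalBits T t.2.2) * hp2

open Polynomial in
theorem index_factor [Algebra (LaurentSeries (ZMod 2)) C] (S : CubeRootSetting T ρ)
    (hT : polyEmb2 C X = T) {ω : C} (hω : ω = T⁻¹ ^ 2 * ρ) {t : (ℕ × ℕ) × ℕ × ℕ}
    (ht : relLeft t = 1) :
    (T⁻¹ - act2 (indexMatrix (X : (ZMod 2)[X]) t) ω) /
        (T⁻¹ - act2 (indexMatrix (X : (ZMod 2)[X]) t) (act2 alpha2 ω)) =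
      evalPair T ρ (addPair (denPair t) (6, 6)) / evalPair T ρ (denPair t) := by
  have hT0 := S.T_ne_zero
  have h2 := S.two_eq_zero
  have h := evalBits_relLeft h2 T t
  rw [ht, evalBits_one] at h
  have hdual := S.dual_row_ne_zero ht
  have hrow := S.evalPair_ne_zero (p := (2 * t.1.2 + 1, 2 * t.1.1)) (by simp only; omega)
  have hrow' := S.evalPair_ne_zero (p := (2 * (2 * t.2.2 + 1), 2 * t.2.1 + 1)) (by simp only; omega)
  have hW := S.evalPair_ne_zero (p := (3, 2 * 1)) (by simp)
  simp only [evalPair, evalBits_two_mul, evalBits_two_mul_add_one, evalBits_three, evalBits_one]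
    at hrow hrow' hW
  rw [S.evalPair_addPair, S.evalPair_denPair]
  simp only [evalPair, evalBits_six]
  simp only [act2, map_evalBits, hT, alpha2, indexMatrix, Matrix.of_apply, Matrix.cons_val',
    Matrix.cons_val_zero, Matrix.cons_val_one, Matrix.cons_val_fin_one, map_add, map_mul, map_pow,
    map_one]
  generalize evalBits T t.1.1 = c at *
  generalize evalBits T t.1.2 = d at *
  generalize evalBits T t.2.1 = e at *
  generalize evalBits T t.2.2 = f at *
  have hρω : ρ = T ^ 2 * ω := by rw [hω]; field_simp
  have hnum := numerator_eq h2 (T := T) (ρ := ρ) (c := c) (d := 1 + T * d) (e := 1 + T * e)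
    (f := 1 + T * f) S.rho_eq h.symm
  set a := (1 + T * e) * (1 + T) + (1 + T * f) * T ^ 2 + T ^ 2 * c with ha
  set b := (1 + T * e) + (1 + T * f) * (T + 1) + f + d with hb
  set R := (1 + T * d) + T * c * ρ with hR
  set R' := (T ^ 3 * c + (1 + T) * (1 + T * d)) + T * ((T ^ 2 + T + 1) * c + (1 + T * d)) * ρ
    with hR'
  set Q := T * (1 + T * f) + (1 + T * e) * ρ with hQ
  set U := (T ^ 2 + T + 1) * ω + 1 with hU
  set W := T ^ 3 * ω + (1 + T) with hW'
  have hW0 : W ≠ 0 := by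
    convert hW using 1
    rw [hW', hρω]
    ring
  have h1 : T⁻¹ - (a * ω + b) / (T ^ 3 * c * ω + (1 + T * d)) =
      (((1 + T * e) * (1 + T) + T ^ 2 * (1 + T * f)) * ρ +
        T * (T * (1 + T * e) + (T ^ 2 + T + 1) * (1 + T * f))) / (T ^ 2 * R) := by
    rw [show T ^ 3 * c * ω + (1 + T * d) = R by rw [hR, hρω]; ring, inv_eq_one_div,
      div_sub_div _ _ hT0 hrow, div_eq_div_iff (mul_ne_zero hT0 hrow)
        (mul_ne_zero (pow_ne_zero 2 hT0) hrow)]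
    have key : T * R - T ^ 2 * (a * ω + b) = ((1 + T * e) * (1 + T) + T ^ 2 * (1 + T * f)) * ρ +
        T * (T * (1 + T * e) + (T ^ 2 + T + 1) * (1 + T * f)) := by
      rw [hR, ha, hb, hρω]
      clear * - h2
      grind
    linear_combination T * R * key
  have h3 : T⁻¹ - (a * (U / W) + b) / (T ^ 3 * c * (U / W) + (1 + T * d)) = Q / (T ^ 2 * R') := by
    have e1 : T ^ 3 * c * (U / W) + (1 + T * d) = R' / W := by
      rw [eq_div_iff hW0, add_mul, mul_assoc, div_mul_cancel₀ _ hW0, hR', hU, hW', hρω]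
      ring
    have e2 : a * (U / W) + b = (a * U + b * W) / W := by
      field_simp
    rw [e1, e2, div_div_div_cancel_right₀ hW0, inv_eq_one_div,
      div_sub_div _ _ hT0 hdual, div_eq_div_iff (mul_ne_zero hT0 hdual)
        (mul_ne_zero (pow_ne_zero 2 hT0) hdual)]
    have key : T * R' - T ^ 2 * (a * U + b * W) = Q := by
      rw [hR', ha, hb, hU, hW', hQ, hρω]
      clear * - h2
      grind
    linear_combination T * R' * key
  rw [h1, h3, div_div_div_eq, div_eq_div_iff
    (mul_ne_zero (mul_ne_zero (pow_ne_zero 2 hT0) hrow) hrow') (mul_ne_zero hrow hrow')]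
  linear_combination T ^ 2 * R * Q * hnum

end CubeRootSetting

/-- The number of values of the third coordinate kept in `indexBox` for given `(c, d)`. -/
def boxBound (p : ℕ × ℕ) : ℕ :=
  let m := max (2 * p.1) (2 * p.2 + 1)
  if m < 2 then 64 else if m < 4 then 32 else if m < 8 then 16 else if m < 16 then 8
  else if m < 32 then 4 else 2

/-- A finite set of indices outside which the factors of the product are close to `1`. -/
def indexBox : Finset ((ℕ × ℕ) × ℕ × ℕ) :=
  {t ∈ (Finset.range 32 ×ˢ Finset.range 32) ×ˢ (Finset.range 64 ×ˢ Finset.range 32) |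
    t.2.1 < boxBound t.1 ∧ t.2.2 < boxBound t.1 / 2}

theorem boxBound_le (p : ℕ × ℕ) : boxBound p ≤ 64 := by
  simp only [boxBound]
  split_ifs <;> norm_num

theorem mem_indexBox {t : (ℕ × ℕ) × ℕ × ℕ} :
    t ∈ indexBox ↔ t.1 ∈ Finset.range 32 ×ˢ Finset.range 32 ∧
      t.2 ∈ Finset.range (boxBound t.1) ×ˢ Finset.range (boxBound t.1 / 2) := by
  have := boxBound_le t.1
  simp only [indexBox, Finset.mem_filter, Finset.mem_product, Finset.mem_range]
  omega

theorem exists_two_pow_le_of_notMem_indexBox {t : (ℕ × ℕ) × ℕ × ℕ} (ht : t ∉ indexBox) :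
    ∃ i j : ℕ, i + j = 7 ∧ 2 ^ i ≤ max (2 * t.1.2 + 1) (2 * t.1.1) ∧
      2 ^ j ≤ max (2 * (2 * t.2.2 + 1)) (2 * t.2.1 + 1) := by
  simp only [mem_indexBox, Finset.mem_product, Finset.mem_range, boxBound] at ht
  by_cases h : t.1.1 < 32 ∧ t.1.2 < 32
  · split_ifs at ht
    · exact ⟨0, 7, rfl, by omega, by omega⟩
    · exact ⟨1, 6, rfl, by omega, by omega⟩
    · exact ⟨2, 5, rfl, by omega, by omega⟩
    · exact ⟨3, 4, rfl, by omega, by omega⟩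
    · exact ⟨4, 3, rfl, by omega, by omega⟩
    · exact ⟨5, 2, rfl, by omega, by omega⟩
  · exact ⟨6, 1, rfl, by omega, by omega⟩

/-- The state reached from `s` by applying `f (n - 1), …, f 0` in turn. -/
def loop {S : Type*} (f : ℕ → S → S) : ℕ → S → S
  | 0, s => s
  | n + 1, s => loop f n (f n s)

theorem map_loop {S M : Type*} [CommMonoid M] {f : ℕ → S → S} {v : S → M} {w : ℕ → M}
    (h : ∀ i s, v (f i s) = v s * w i) (n : ℕ) (s : S) :
    v (loop f n s) = v s * ∏ i ∈ Finset.range n, w i := by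
  induction n generalizing s with
  | zero => simp [loop]
  | succ n ih => rw [loop, ih, h, Finset.prod_range_succ, mul_assoc, mul_comm (w n)]

theorem map_loop_loop {S M : Type*} [CommMonoid M] {f : ℕ → ℕ → S → S} {v : S → M} {w : ℕ × ℕ → M}
    (h : ∀ i j s, v (f i j s) = v s * w (i, j)) (m n : ℕ) (s : S) :
    v (loop (fun i => loop (f i) n) m s) =
      v s * ∏ p ∈ Finset.range m ×ˢ Finset.range n, w p := by
  rw [Finset.prod_product]
  exact map_loop (w := fun i => ∏ j ∈ Finset.range n, w (i, j)) (fun i => map_loop (h i) n) m s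

theorem map_iterated_loop {S M : Type*} [CommMonoid M] {f : (ℕ × ℕ) × ℕ × ℕ → S → S} {v : S → M}
    {w : (ℕ × ℕ) × ℕ × ℕ → M} (h : ∀ t s, v (f t s) = v s * w t) (k l : ℕ) (m n : ℕ × ℕ → ℕ)
    (s : S) :
    v (loop (fun a => loop (fun b => loop (fun c => loop (fun d => f ((a, b), c, d))
      (n (a, b))) (m (a, b))) l) k s) =
      v s * ∏ p ∈ Finset.range k ×ˢ Finset.range l,
        ∏ q ∈ Finset.range (m p) ×ˢ Finset.range (n p), w (p, q) :=
  map_loop_loop (w := fun p => ∏ q ∈ Finset.range (m p) ×ˢ Finset.range (n p), w (p, q))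
    (fun a b => map_loop_loop (fun c d => h ((a, b), c, d)) (m (a, b)) (n (a, b))) k l s

/-- Multiply the fraction `s` by the factor with index `t`, if `t` indexes an element of `Γ₀(T³)`. -/
def stepFraction (t : (ℕ × ℕ) × ℕ × ℕ) (s : (ℕ × ℕ) × ℕ × ℕ) : (ℕ × ℕ) × ℕ × ℕ :=
  if relLeft t = 1 then
    (mulPair s.1 (addPair (denPair t) (6, 6)), mulPair s.2 (denPair t))
  else s

/-- Numerator and denominator of the partial product over `indexBox`. -/
def boxFraction : (ℕ × ℕ) × ℕ × ℕ :=
  loop (fun a => loop (fun b => loop (fun c => loop (fun d => stepFraction ((a, b), c, d))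
    (boxBound (a, b) / 2)) (boxBound (a, b))) 32) 32 ((1, 0), 1, 0)

set_option maxRecDepth 100000 in
theorem boxFraction_estimate :
    boxFraction.1.1 ^^^ 2 * boxFraction.2.1 < 2 ^ 310 ∧
      boxFraction.1.2 ^^^ 2 * boxFraction.2.2 < 2 ^ 310 ∧ 2 ^ 313 ≤ boxFraction.2.1 := by
  decide +kernel

/-- The factor of the product with index `t`, extended by `1` to indices outside `Γ₀(T³)`. -/
def indexFactor {C : Type*} [NormedField C] (T ρ : C) (t : (ℕ × ℕ) × ℕ × ℕ) : C :=
  if relLeft t = 1 then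
    evalPair T ρ (addPair (denPair t) (6, 6)) / evalPair T ρ (denPair t)
  else 1

namespace CubeRootSetting

variable {C : Type*} [NormedField C] {T ρ : C}

theorem prod_indexFactor (S : CubeRootSetting T ρ) :
    ∏ t ∈ indexBox, indexFactor T ρ t =
      evalPair T ρ boxFraction.1 / evalPair T ρ boxFraction.2 := by
  have hstep : ∀ t s, evalPair T ρ (stepFraction t s).1 / evalPair T ρ (stepFraction t s).2 =
      evalPair T ρ s.1 / evalPair T ρ s.2 * indexFactor T ρ t := by
    intro t s
    rw [stepFraction, indexFactor]
    split_ifs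
    · rw [S.evalPair_mulPair, S.evalPair_mulPair, mul_div_mul_comm]
    · rw [mul_one]
  rw [Finset.prod_finset_product indexBox (Finset.range 32 ×ˢ Finset.range 32)
    (fun p => Finset.range (boxBound p) ×ˢ Finset.range (boxBound p / 2)) fun _ => mem_indexBox]
  have hloop := map_iterated_loop
    (v := fun s : (ℕ × ℕ) × ℕ × ℕ => evalPair T ρ s.1 / evalPair T ρ s.2) hstep 32 32
    boxBound (boxBound · / 2) ((1, 0), 1, 0)
  simp only [evalPair, evalBits_one, evalBits_zero, zero_mul, add_zero, div_one, one_mul] at hloop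
  exact hloop.symm

theorem norm_indexFactor_sub_one_le (S : CubeRootSetting T ρ) (t : (ℕ × ℕ) × ℕ × ℕ) {r : ℝ}
    (hr : 0 < r) (h : r ≤ ‖evalPair T ρ (denPair t)‖) : ‖indexFactor T ρ t - 1‖ ≤ 4 / r := by
  rw [indexFactor]
  split_ifs
  · have h0 : evalPair T ρ (denPair t) ≠ 0 := norm_pos_iff.mp (hr.trans_le h)
    rw [S.evalPair_addPair, add_div, div_self h0, add_sub_cancel_left, norm_div]
    have := S.norm_evalPair_le 2 (6, 6) (by norm_num) (by norm_num)
    exact div_le_div₀ (by norm_num) (this.trans_eq (by norm_num)) hr h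
  · rw [sub_self, norm_zero]
    positivity

theorem norm_denPair (S : CubeRootSetting T ρ) (t : (ℕ × ℕ) × ℕ × ℕ) :
    ‖evalPair T ρ (denPair t)‖ = ‖evalPair T ρ (2 * t.1.2 + 1, 2 * t.1.1)‖ *
      ‖evalPair T ρ (2 * (2 * t.2.2 + 1), 2 * t.2.1 + 1)‖ := by
  rw [denPair, S.evalPair_mulPair, norm_mul]

theorem norm_indexFactor_sub_one_le_of_notMem (S : CubeRootSetting T ρ)
    {t : (ℕ × ℕ) × ℕ × ℕ} (ht : t ∉ indexBox) : ‖indexFactor T ρ t - 1‖ ≤ 1 / 32 := by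
  obtain ⟨i, j, hij, hi, hj⟩ := exists_two_pow_le_of_notMem_indexBox ht
  refine (S.norm_indexFactor_sub_one_le t (r := 2 ^ 7) (by norm_num) ?_).trans (by norm_num)
  rw [S.norm_denPair, ← hij, pow_add]
  exact mul_le_mul (S.le_norm_evalPair i _ hi) (S.le_norm_evalPair j _ hj) (by positivity)
    (norm_nonneg _)

theorem multipliable_indexFactor [CompleteSpace C] (S : CubeRootSetting T ρ) :
    Multipliable (indexFactor T ρ) := by
  refine S.multipliable_of_finite fun ε hε => ?_
  obtain ⟨n, hn⟩ := pow_unbounded_of_one_lt (4 / ε) (one_lt_two : (1 : ℝ) < 2)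
  have hn' : 4 / 2 ^ n ≤ ε := by
    rw [div_lt_iff₀ hε] at hn
    rw [div_le_iff₀ (by positivity)]
    linarith
  refine (((Finset.range (2 ^ n) ×ˢ Finset.range (2 ^ n)) ×ˢ
    (Finset.range (2 ^ n) ×ˢ Finset.range (2 ^ n))).finite_toSet).subset fun t ht => ?_
  by_contra hmem
  refine absurd ht (not_lt.mpr ((S.norm_indexFactor_sub_one_le t (by positivity) ?_).trans hn'))
  have hrow := S.one_le_norm_evalPair (p := (2 * t.1.2 + 1, 2 * t.1.1)) (by simp only; omega)
  have hrow' := S.one_le_norm_evalPair (p := (2 * (2 * t.2.2 + 1), 2 * t.2.1 + 1))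
    (by simp only; omega)
  rw [S.norm_denPair]
  simp only [SetLike.mem_coe, Finset.mem_product, Finset.mem_range] at hmem
  by_cases h : 2 ^ n ≤ max (2 * t.1.2 + 1) (2 * t.1.1)
  · exact (S.le_norm_evalPair n (2 * t.1.2 + 1, 2 * t.1.1) h).trans
      (le_mul_of_one_le_right (norm_nonneg _) hrow')
  · exact (S.le_norm_evalPair n (2 * (2 * t.2.2 + 1), 2 * t.2.1 + 1) (by simp only; omega)).trans
      (le_mul_of_one_le_left (norm_nonneg _) hrow)

set_option exponentiation.threshold 400 in
theorem norm_prod_indexFactor_sub_le (S : CubeRootSetting T ρ) :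
    ‖∏ t ∈ indexBox, indexFactor T ρ t - T‖ ≤ 1 / 16 := by
  obtain ⟨h1, h2, h3⟩ := boxFraction_estimate
  rw [S.prod_indexFactor]
  generalize boxFraction = s at *
  have hden := S.le_norm_evalPair 313 s.2 (h3.trans (le_max_left _ _))
  have hden0 : evalPair T ρ s.2 ≠ 0 := norm_pos_iff.mp (lt_of_lt_of_le (by positivity) hden)
  have hnum := S.norm_evalPair_le 309 (addPair s.1 (2 * s.2.1, 2 * s.2.2)) h1 h2
  have heq : evalPair T ρ s.1 / evalPair T ρ s.2 - T =
      evalPair T ρ (addPair s.1 (2 * s.2.1, 2 * s.2.2)) / evalPair T ρ s.2 := by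
    rw [S.evalPair_addPair, eq_div_iff hden0, sub_mul, div_mul_cancel₀ _ hden0]
    simp only [evalPair, evalBits_two_mul]
    linear_combination -(T * (evalBits T s.2.1 + evalBits T s.2.2 * ρ)) * S.two_eq_zero
  rw [heq, norm_div]
  refine (div_le_div₀ (by positivity) hnum (by positivity) hden).trans_eq ?_
  rw [show (313 : ℕ) = 309 + 4 from rfl, pow_add, div_mul_cancel_left₀ (by positivity)]
  norm_num

theorem norm_tprod_indexFactor_sub_lt [CompleteSpace C] (S : CubeRootSetting T ρ) :
    ‖∏' t, indexFactor T ρ t - T‖ < 1 / 8 := by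
  have h1 := S.norm_prod_indexFactor_sub_le
  have h2 := S.norm_tprod_sub_prod_le (by norm_num) (by norm_num) S.multipliable_indexFactor
    fun _ => S.norm_indexFactor_sub_one_le_of_notMem
  have h3 : ‖∏ t ∈ indexBox, indexFactor T ρ t‖ = 2 := by
    rw [← S.norm_T, ← S.norm_add_eq_left (x := T) (y := ∏ t ∈ indexBox, indexFactor T ρ t - T)
      (by rw [S.norm_T]; linarith), add_sub_cancel]
  rw [h3] at h2
  have := S.norm_add_le (∏' t, indexFactor T ρ t - ∏ t ∈ indexBox, indexFactor T ρ t)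
    (∏ t ∈ indexBox, indexFactor T ρ t - T)
  rw [sub_add_sub_cancel] at this
  exact this.trans_lt (max_lt (by linarith) (by linarith))

end CubeRootSetting

theorem norm_polyEmb2_X {C : Type*} [NormedField C] [Algebra (LaurentSeries (ZMod 2)) C]
    (hext : ∀ x : LaurentSeries (ZMod 2), ‖algebraMap (LaurentSeries (ZMod 2)) C x‖ = absK2 x) :
    ‖polyEmb2 C Polynomial.X‖ = 2 := by
  have h : polyEmb2 C Polynomial.X = algebraMap (LaurentSeries (ZMod 2)) C Tel2 := by
    simp [polyEmb2]
  have h0 : Tel2 ≠ 0 := HahnSeries.single_ne_zero one_ne_zero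
  rw [h, hext, absK2, if_neg h0, Tel2, HahnSeries.order_single one_ne_zero]
  norm_num

/-- **Part of Proposition 8.1.**  With `ω = T⁻²·ρ` (`ρ² + ρ + 1 = 0`), the family
`γ ↦ (1/T - γω)/(1/T - γ(αω))`, indexed by `γ ∈ Γ = Γ₀(T³)`, is multipliable, and its
product `u_α(1/T)` satisfies `|u_α(1/T) - T| < 2⁻³` (note `π⁻¹ = T`). -/
theorem u_alpha_at_one_over_T {C : Type*} [NormedField C] [CompleteSpace C]
    [Algebra (LaurentSeries (ZMod 2)) C]
    (hna : ∀ x y : C, ‖x + y‖ ≤ max ‖x‖ ‖y‖)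
    (hext : ∀ x : LaurentSeries (ZMod 2), ‖algebraMap (LaurentSeries (ZMod 2)) C x‖ = absK2 x)
    (ρ : C) (hρ : ρ ^ 2 + ρ + 1 = 0)
    (ω : C) (hω : ω = (polyEmb2 C Polynomial.X) ⁻¹ ^ 2 * ρ) :
    Multipliable (fun γ : Gamma0T3 =>
      ((polyEmb2 C Polynomial.X)⁻¹ - act2 γ.val ω) /
        ((polyEmb2 C Polynomial.X)⁻¹ - act2 γ.val (act2 alpha2 ω))) ∧
    ‖(∏' γ : Gamma0T3, ((polyEmb2 C Polynomial.X)⁻¹ - act2 γ.val ω) /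
          ((polyEmb2 C Polynomial.X)⁻¹ - act2 γ.val (act2 alpha2 ω)))
        - polyEmb2 C Polynomial.X‖ < (2 : ℝ) ^ (-3 : ℤ) := by
  set T := polyEmb2 C Polynomial.X with hT
  have S : CubeRootSetting T ρ :=
    { norm_add_le := hna
      two_eq_zero := by
        simpa only [map_ofNat, map_zero] using
          congrArg (polyEmb2 C) (CharTwo.two_eq_zero (R := Polynomial (ZMod 2)))
      norm_T := norm_polyEmb2_X hext
      rho_eq := hρ }
  let index : Gamma0T3 → (ℕ × ℕ) × ℕ × ℕ := fun γ =>
    ((Equiv.ofBijective _ indexToGamma_bijective).symm γ).1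
  have hinj : Function.Injective index := Subtype.val_injective.comp (Equiv.injective _)
  have hfactor : (fun γ : Gamma0T3 => (T⁻¹ - act2 γ.val ω) / (T⁻¹ - act2 γ.val (act2 alpha2 ω))) =
      indexFactor T ρ ∘ index := by
    funext γ
    obtain ⟨t, rfl⟩ := (Equiv.ofBijective _ indexToGamma_bijective).surjective γ
    simp only [index, Function.comp_apply, Equiv.symm_apply_apply, indexFactor, if_pos t.2]
    exact S.index_factor hT.symm hω t.2
  have hout : ∀ t, t ∉ Set.range index → indexFactor T ρ t = 1 := by
    intro t ht
    refine if_neg fun h => ht ⟨indexToGamma ⟨t, h⟩, ?_⟩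
    exact congrArg Subtype.val
      ((Equiv.ofBijective _ indexToGamma_bijective).symm_apply_apply ⟨t, h⟩)
  have htprod : ∏' γ, (indexFactor T ρ ∘ index) γ = ∏' t, indexFactor T ρ t :=
    hinj.tprod_eq fun t ht => by
      by_contra h
      exact ht (hout t h)
  rw [hfactor]
  refine ⟨(hinj.multipliable_iff hout).mpr S.multipliable_indexFactor, ?_⟩
  have := S.norm_tprod_indexFactor_sub_lt
  rw [← htprod] at this
  refine lt_of_lt_of_eq this ?_
  norm_num
end
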